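/- Assume f ∈ C_b(Ω) takes the form f(ω) = π_ω(0)^{-1} (∇*(c v))(ω) for some v ∈ C_b(Ω,ℝ^d). Then for all p,q > 1 and all ω ∈ Ω* ∩ Ω_{p,q}: (i) ⟨f,(−L)^{-1}f⟩_{L²(Q_ω)} < ∞, and (ii) with π_ω(Λ_r) := Σ_{x∈Λ_r} π_ω(x), one has π_ω(Λ_r)^{-1} ⟨f∘τ(ω), (−𝖫_ω)^{-1}_{Λ_r} f∘τ(ω)⟩_{ℓ²(Λ_r,π_ω)} → ⟨f,(−L)^{-1}f⟩_{L²(Q_ω)} as r → ∞. -/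

import Mathlib

open MeasureTheory Filter Topology Matrix
open scoped ENNReal NNReal

noncomputable section

namespace DetCond

/-- Vertices of `ℤ^d`. -/
abbrev Vert (d : ℕ) := Fin d → ℤ

/-- Index of the (unordered) nearest-neighbour edge `(x, x + e i)` of `ℤ^d`;
the set of these indices is in natural bijection with `E(ℤ^d)` modulo orientation. -/
abbrev EdgeIx (d : ℕ) := Vert d × Fin d

/-- The space `Ω = (0,∞)^{E(ℤ^d)}` of (symmetric) conductance configurations, with
its product topology and product σ-algebra. -/
abbrev EnvSp (d : ℕ) := {ω : EdgeIx d → ℝ // ∀ e, 0 < ω e}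

/-- The `i`-th coordinate unit vector of `ℤ^d`. -/
def unitv (d : ℕ) (i : Fin d) : Vert d := fun j => if j = i then 1 else 0

/-- The translation `τ_x` acting on environments: `c_{τ_x ω}(y,z) = c_ω(y+x,z+x)`. -/
def shift (d : ℕ) (x : Vert d) (ω : EnvSp d) : EnvSp d :=
  ⟨fun e => ω.1 (e.1 + x, e.2), fun e => ω.2 (e.1 + x, e.2)⟩

/-- The conductance `c_ω(x,y)`; it vanishes when `x,y` are not nearest neighbours
and is symmetric in `x,y` by construction. -/
def cnd (d : ℕ) (ω : EnvSp d) (x y : Vert d) : ℝ :=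
  ∑ i, ((if y = x + unitv d i then ω.1 (x, i) else 0) +
        (if x = y + unitv d i then ω.1 (y, i) else 0))

/-- `π_ω(x) = Σ_{z : (x,z) ∈ E(ℤ^d)} c_ω(x,z)`. -/
def piOf (d : ℕ) (ω : EnvSp d) (x : Vert d) : ℝ :=
  ∑ i, (ω.1 (x, i) + ω.1 (x - unitv d i, i))

/-- The box `Λ_r = [-r,r]^d ∩ ℤ^d`. -/
def box (d : ℕ) (r : ℝ) : Finset (Vert d) :=
  Fintype.piFinset fun _ : Fin d => Finset.Icc ⌈-r⌉ ⌊r⌋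

/-- The nearest neighbours of `x` in `ℤ^d`. -/
def nbrs (d : ℕ) (x : Vert d) : Finset (Vert d) :=
  (Finset.univ.image fun i => x + unitv d i) ∪ (Finset.univ.image fun i => x - unitv d i)

/-- The set `E(Λ)` of edges incident with at least one vertex of `Λ`
(one index per unordered edge). -/
def edgesIn (d : ℕ) (Λ : Finset (Vert d)) : Finset (EdgeIx d) :=
  Λ.biUnion fun x =>
    (Finset.univ.image fun i => (x, i)) ∪ (Finset.univ.image fun i => (x - unitv d i, i))

/-- Bounded functions on `Ω`. -/
def IsBdd (d : ℕ) (f : EnvSp d → ℝ) : Prop := ∃ M, ∀ ω, |f ω| ≤ M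

/-- Local functions: `f` depends only on the coordinates in some finite set `B` of edges
and, viewed as a function of those coordinates, has compact support in `(0,∞)^B`. -/
def IsLocalFn (d : ℕ) (f : EnvSp d → ℝ) : Prop :=
  ∃ B : Finset (EdgeIx d),
    (∀ ω₁ ω₂ : EnvSp d, (∀ e ∈ B, ω₁.1 e = ω₂.1 e) → f ω₁ = f ω₂) ∧
    ∃ a b : ℝ, 0 < a ∧ ∀ ω : EnvSp d, (∃ e ∈ B, ω.1 e < a ∨ b < ω.1 e) → f ω = 0

/-- `ℓ_ω(f) = L`, i.e. the block averages of the translates of `f` converge to `L`. -/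
def avgTo (d : ℕ) (ω : EnvSp d) (f : EnvSp d → ℝ) (L : ℝ) : Prop :=
  Tendsto (fun n : ℕ => (∑ x ∈ box d (n : ℝ), f (shift d x ω)) / ((box d (n : ℝ)).card : ℝ))
    atTop (𝓝 L)

/-- `ω` is averaging: `ℓ_ω(f)` exists for every continuous local `f`. -/
def Averaging (d : ℕ) (ω : EnvSp d) : Prop :=
  ∀ f : EnvSp d → ℝ, Continuous f → IsLocalFn d f → ∃ L, avgTo d ω f L

/-- `ω` is tempered, i.e. `ω ∈ Ω'`. -/
def Tempered (d : ℕ) (ω : EnvSp d) : Prop :=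
  Tendsto (fun ε : ℝ =>
      limsup (fun n : ℕ =>
        (∑ e ∈ edgesIn d (box d (n : ℝ)),
            (if ε ≤ ω.1 e ∧ ω.1 e ≤ ε⁻¹ then (0:ℝ) else 1)) / (n : ℝ) ^ d) atTop)
    (𝓝[>] 0) (𝓝 0)

/-- `P` is the measure `ℙ_ω` associated with an averaging tempered `ω`:
the unique probability measure whose expectation of every bounded continuous function
is the corresponding block-average limit `ℓ_ω(f)`. -/
def IsEnvLaw (d : ℕ) (ω : EnvSp d) (P : Measure (EnvSp d)) : Prop :=
  IsProbabilityMeasure P ∧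
    ∀ f : EnvSp d → ℝ, Continuous f → IsBdd d f → avgTo d ω f (∫ ω', f ω' ∂P)

/-- Ergodicity of a measure on `Ω` with respect to the translations of `ℤ^d`. -/
def ErgodicEnv (d : ℕ) (P : Measure (EnvSp d)) : Prop :=
  ∀ A : Set (EnvSp d), MeasurableSet A → (∀ x : Vert d, shift d x ⁻¹' A = A) →
    P A = 0 ∨ P A = 1

/-- `ω ∈ Ω⋆`: tempered, averaging, and the associated measure `ℙ_ω` is ergodic. -/
def InOmegaStar (d : ℕ) (ω : EnvSp d) : Prop :=
  Tempered d ω ∧ Averaging d ω ∧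
    ∀ P : Measure (EnvSp d), IsEnvLaw d ω P → ErgodicEnv d P

/-- `ω ∈ Ω_{p,q}`. -/
def InOmegaPQ (d : ℕ) (p q : ℝ) (ω : EnvSp d) : Prop :=
  (∃ C : ℝ, ∀ n : ℕ, 1 ≤ n →
      (∑ e ∈ edgesIn d (box d (n : ℝ)), ω.1 e ^ p) / (n : ℝ) ^ d ≤ C) ∧
  (∃ C : ℝ, ∀ n : ℕ, 1 ≤ n →
      (∑ e ∈ edgesIn d (box d (n : ℝ)), ω.1 e ^ (-q)) / (n : ℝ) ^ d ≤ C)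

/-- The path space of the discrete-time walk. -/
abbrev Path (d : ℕ) := ℕ → Vert d

/-- One-step transition probabilities `𝖯_ω(x,y) = c_ω(x,y)/π_ω(x)`. -/
def transP (d : ℕ) (ω : EnvSp d) (x y : Vert d) : ℝ := cnd d ω x y / piOf d ω x

/-- `μ` is the law `P_ω^{x₀}` of the random walk among the conductances `ω`
started at `x₀`: a probability measure on the path space with the prescribed
finite-dimensional (cylinder) probabilities. -/
def IsWalkLaw (d : ℕ) (ω : EnvSp d) (x₀ : Vert d) (μ : Measure (Path d)) : Prop :=
  IsProbabilityMeasure μ ∧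
    ∀ (n : ℕ) (γ : ℕ → Vert d),
      μ {w | ∀ k ≤ n, w k = γ k} =
        (if γ 0 = x₀ then 1 else 0) *
          ∏ k ∈ Finset.range n, ENNReal.ofReal (transP d ω (γ k) (γ (k+1)))

/-- `n`-step transition probabilities of the discrete-time walk. -/
def stepP (d : ℕ) (ω : EnvSp d) : ℕ → Vert d → Vert d → ℝ
  | 0, x, y => if x = y then 1 else 0
  | n+1, x, y => ∑ z ∈ nbrs d x, transP d ω x z * stepP d ω n z y

/-- `P_ω^x(Y_t = y)` for the constant-speed continuous-time walk `Y_t = X_{N(t)}`,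
where `N` is an independent rate-1 Poisson process. -/
def ctP (d : ℕ) (ω : EnvSp d) (t : ℝ) (x y : Vert d) : ℝ :=
  ∑' k : ℕ, Real.exp (-t) * t ^ k / (Nat.factorial k : ℝ) * stepP d ω k x y

/-- The `ℓ¹`-norm of a vertex of `ℤ^d`. -/
def l1 (d : ℕ) (x : Vert d) : ℝ := ∑ i, |(x i : ℝ)|

/-- A vertex of `ℤ^d` regarded as a point of `ℝ^d`. -/
def ivert (d : ℕ) (x : Vert d) : Fin d → ℝ := fun i => (x i : ℝ)

/-- The linearly interpolated diffusively rescaled walk `B^{(n)}`. -/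
def BnProc (d : ℕ) (n : ℕ) (w : Path d) (t : ℝ) : Fin d → ℝ :=
  (Real.sqrt n)⁻¹ •
    (ivert d (w ⌊t * n⌋₊) +
      (t * n - (⌊t * n⌋₊ : ℝ)) • (ivert d (w (⌊t * n⌋₊ + 1)) - ivert d (w ⌊t * n⌋₊)))


/-- The measure `ℚ_ω` obtained from `ℙ_ω` by tilting with `π(0)`. -/
def Qmeas (d : ℕ) (P : Measure (EnvSp d)) : Measure (EnvSp d) :=
  P.withDensity fun ω' => ENNReal.ofReal (piOf d ω' 0 / ∫ ω'', piOf d ω'' 0 ∂P)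

/-- The inner product `⟨f,g⟩_{L²(πμ)}`. -/
def innerP (d : ℕ) (P : Measure (EnvSp d)) (f g : EnvSp d → ℝ) : ℝ :=
  ∫ ω', f ω' * g ω' * piOf d ω' 0 ∂P

/-- The Dirichlet pairing `⟨h, (−L)h⟩_{L²(πμ)}`. -/
def quadL (d : ℕ) (P : Measure (EnvSp d)) (h : EnvSp d → ℝ) : ℝ :=
  ∫ ω', (∑ z ∈ nbrs d 0, cnd d ω' 0 z * (h ω' - h (shift d z ω'))) * h ω' ∂P

/-- The inner product of `L²(ν)`. -/
def innerQ (d : ℕ) (ν : Measure (EnvSp d)) (f g : EnvSp d → ℝ) : ℝ :=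
  ∫ ω', f ω' * g ω' ∂ν

/-- The Dirichlet pairing `⟨h, (−L)h⟩_{L²(ν)}`. -/
def quadQ (d : ℕ) (ν : Measure (EnvSp d)) (h : EnvSp d → ℝ) : ℝ :=
  ∫ ω', ((piOf d ω' 0)⁻¹ *
      ∑ z ∈ nbrs d 0, cnd d ω' 0 z * (h ω' - h (shift d z ω'))) * h ω' ∂ν

/-- The set whose supremum is the variational characterization
`⟨f,(−L)⁻¹f⟩_{L²(ν)} = sup_h [2⟨h,f⟩ − ⟨h,(−L)h⟩]` (over bounded continuous `h`);
`⟨f,(−L)⁻¹f⟩_{L²(ν)} < ∞` means this set is bounded above. -/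
def invPairSet (d : ℕ) (ν : Measure (EnvSp d)) (f : EnvSp d → ℝ) : Set ℝ :=
  {r | ∃ h : EnvSp d → ℝ, Continuous h ∧ IsBdd d h ∧
        r = 2 * innerQ d ν h f - quadQ d ν h}

/-- The function `f(ω) = π_ω(0)⁻¹ ∇⋆(c v)(ω)` built from a vector field `v`. -/
def fDiv (d : ℕ) (v : EnvSp d → Fin d → ℝ) (ω : EnvSp d) : ℝ :=
  (piOf d ω 0)⁻¹ *
    ∑ i, (cnd d ω 0 (unitv d i) * v ω i -
          cnd d ω (-(unitv d i)) 0 * v (shift d (-(unitv d i)) ω) i)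

/-- The inner product of `ℓ²(Λ,π_ω)`. -/
def innerF (d : ℕ) (ω : EnvSp d) (Λ : Finset (Vert d)) (f g : Vert d → ℝ) : ℝ :=
  ∑ x ∈ Λ, f x * g x * piOf d ω x

/-- The pairing `⟨h, (−𝖫_ω)h⟩_{ℓ²(Λ,π_ω)}` for `h` vanishing outside `Λ`. -/
def quadF (d : ℕ) (ω : EnvSp d) (Λ : Finset (Vert d)) (h : Vert d → ℝ) : ℝ :=
  ∑ x ∈ Λ, (∑ z ∈ nbrs d x, cnd d ω x z * (h x - h z)) * h x

/-- `⟨f, (−𝖫_ω)⁻¹_Λ f⟩_{ℓ²(Λ,π_ω)}` via its variational characterization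
`sup_h [2⟨h,f⟩ − ⟨h,(−𝖫_ω)h⟩]` over `h ∈ ℓ²(Λ,π_ω)`. -/
def invPairF (d : ℕ) (ω : EnvSp d) (Λ : Finset (Vert d)) (f : Vert d → ℝ) : ℝ :=
  sSup {r | ∃ h : Vert d → ℝ, (∀ x ∉ Λ, h x = 0) ∧
      r = 2 * innerF d ω Λ h f - quadF d ω Λ h}

/-- The antisymmetric edge function `v∘τ(ω)`: the value assigned to the
edge `(x, x+e_i)` is `v_i(τ_x(ω))`. -/
def efield (d : ℕ) (v : EnvSp d → Fin d → ℝ) (ω : EnvSp d) : Vert d → Fin d → ℝ :=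
  fun x i => v (shift d x ω) i

/-- The discrete gradient `∇h` of `h : ℤ^d → ℝ` as an edge function. -/
def dgradE (d : ℕ) (h : Vert d → ℝ) : Vert d → Fin d → ℝ :=
  fun x i => h (x + unitv d i) - h x

/-- The inner product `⟨u,w⟩_{ℓ²(E(Λ), c_ω)}` of (antisymmetric) edge functions;
each unordered edge is counted once, which agrees with the paper's sum over
ordered edges carrying the factor ½. -/
def einner (d : ℕ) (ω : EnvSp d) (Λ : Finset (Vert d)) (u w : Vert d → Fin d → ℝ) : ℝ :=
  ∑ e ∈ edgesIn d Λ, u e.1 e.2 * w e.1 e.2 * ω.1 e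

/-- The Dirichlet energy `𝓔_Λ^ω(v)`. -/
def direnergy (d : ℕ) (ω : EnvSp d) (Λ : Finset (Vert d)) (v : EnvSp d → Fin d → ℝ) : ℝ :=
  sInf {r | ∃ h : Vert d → ℝ, (∀ x ∉ Λ, h x = 0) ∧
      r = einner d ω Λ (fun x i => efield d v ω x i - dgradE d h x i)
            (fun x i => efield d v ω x i - dgradE d h x i)}

/-- The gradient `∇h` of a function on `Ω`. -/
def gradOmega (d : ℕ) (h : EnvSp d → ℝ) : EnvSp d → Fin d → ℝ :=
  fun ω i => h (shift d (unitv d i) ω) - h ω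

/-- The inner product `⟨u, c w⟩_{L²(P,ℝ^d)}`. -/
def cinnerP (d : ℕ) (P : Measure (EnvSp d)) (u w : EnvSp d → Fin d → ℝ) : ℝ :=
  ∑ i, ∫ ω', cnd d ω' 0 (unitv d i) * u ω' i * w ω' i ∂P

/-- Bounded vector fields on `Ω`. -/
def IsBddV (d : ℕ) (v : EnvSp d → Fin d → ℝ) : Prop := ∃ M, ∀ ω i, |v ω i| ≤ M

/-- The space `𝒱 = (ℝ^d)^{ℤ^d}` of vector fields on `ℤ^d`. -/
abbrev VS (d : ℕ) := Vert d → Fin d → ℝ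

/-- The empirical measures `μ_r^{ω,v}` built from the minimizers `h_r` of the
finite-volume Dirichlet energies. -/
def muR (d : ℕ) (ω : EnvSp d) (hr : ℕ → Vert d → ℝ) (r : ℕ) :
    Measure (EnvSp d × VS d) :=
  (((box d ((r : ℝ) + Real.sqrt r)).card : ℝ≥0∞) *
      ((box d (Real.sqrt r)).card : ℝ≥0∞))⁻¹ •
    ∑ z ∈ box d (Real.sqrt r), ∑ x ∈ box d ((r : ℝ) + Real.sqrt r),
      Measure.dirac (shift d (x + z) ω, fun y => dgradE d (hr r) (x + z + y))

/-- The localized conductances `c_ω^R`. -/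
def cR (d : ℕ) (ω : EnvSp d) (R : ℝ) (e : EdgeIx d) : ℝ :=
  if e ∈ edgesIn d (box d (2 * R)) then ω.1 e else 1

/-- The localized measure `π_ω^R`. -/
def piRloc (d : ℕ) (ω : EnvSp d) (R : ℝ) (x : Vert d) : ℝ :=
  if x ∈ box d (2 * R) then piOf d ω x
  else if x ∈ box d (4 * R) then 1 + piOf d ω x else 1

/-- The localized Dirichlet form `D_ω^R(f,f)` (each unordered edge counted once). -/
def DR (d : ℕ) (ω : EnvSp d) (R : ℝ) (f : Vert d → ℝ) : ℝ≥0∞ :=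
  ∑' e : EdgeIx d, ENNReal.ofReal (cR d ω R e * (f (e.1 + unitv d e.2) - f e.1) ^ 2)

/-- The norm `‖f‖_{ℓ^s(μ)}`. -/
def lpN (d : ℕ) (μw : Vert d → ℝ) (s : ℝ) (f : Vert d → ℝ) : ℝ≥0∞ :=
  (∑' x : Vert d, ENNReal.ofReal (|f x| ^ s * μw x)) ^ (1 / s)

/-- The exponent `ε = 2(2/d − 1/p − 1/q)((d−2)/d + 1/q)⁻¹`. -/
def epsPQ (d : ℕ) (p q : ℝ) : ℝ :=
  2 * (2 / (d : ℝ) - 1 / p - 1 / q) / (((d : ℝ) - 2) / (d : ℝ) + 1 / q)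

/-- Jump rates of the localized constant-speed chain `Y^R`:
rate `c_ω^R(x,y)/π_ω^R(x)` from `x` to `y`. -/
def rateR (d : ℕ) (ω : EnvSp d) (R : ℝ) (x y : Vert d) : ℝ :=
  (∑ i, ((if y = x + unitv d i then cR d ω R (x, i) else 0) +
         (if x = y + unitv d i then cR d ω R (y, i) else 0))) / piRloc d ω R x

/-- The generator matrix of `Y^R`. -/
def qmatR (d : ℕ) (ω : EnvSp d) (R : ℝ) (x y : Vert d) : ℝ :=
  if x = y then -(∑ z ∈ nbrs d x, rateR d ω R x z) else rateR d ω R x y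

/-- Iterates of the generator matrix of `Y^R`. -/
def qiter (d : ℕ) (ω : EnvSp d) (R : ℝ) : ℕ → Vert d → Vert d → ℝ
  | 0, x, y => if x = y then 1 else 0
  | n+1, x, y => ∑ z ∈ insert x (nbrs d x), qmatR d ω R x z * qiter d ω R n z y

/-- The heat kernel `P_ω^x(Y_t^R = y) = (e^{tQ})(x,y)` of the localized chain `Y^R`. -/
def hkR (d : ℕ) (ω : EnvSp d) (R : ℝ) (t : ℝ) (x y : Vert d) : ℝ :=
  ∑' k : ℕ, t ^ k / (Nat.factorial k : ℝ) * qiter d ω R k x y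

instance pseudoMetrizableSpace_envSp (d : ℕ) :
    TopologicalSpace.PseudoMetrizableSpace (EnvSp d) := by
  have : TopologicalSpace.PseudoMetrizableSpace (EdgeIx d → ℝ) :=
    UniformSpace.pseudoMetrizableSpace
  exact Topology.IsInducing.subtypeVal.pseudoMetrizableSpace

lemma shift_shift (d : ℕ) (x y : Vert d) (ω : EnvSp d) :
    shift d x (shift d y ω) = shift d (x + y) ω := by
  ext e
  simp [shift, add_assoc]

lemma shift_zero (d : ℕ) (ω : EnvSp d) : shift d 0 ω = ω := by
  ext e
  simp [shift]

lemma shift_apply (d : ℕ) (x : Vert d) (ω : EnvSp d) (e : EdgeIx d) :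
    (shift d x ω).1 e = ω.1 (e.1 + x, e.2) := rfl

lemma continuous_shift (d : ℕ) (x : Vert d) : Continuous (shift d x) := by
  refine Continuous.subtype_mk (continuous_pi fun e => ?_) _
  exact (continuous_apply (e.1 + x, e.2)).comp continuous_subtype_val

lemma measurable_shift (d : ℕ) (x : Vert d) : Measurable (shift d x) :=
  (continuous_shift d x).measurable

lemma continuous_coord (d : ℕ) (e : EdgeIx d) : Continuous fun ω : EnvSp d => ω.1 e :=
  (continuous_apply e).comp continuous_subtype_val

section Boxes

lemma mem_box_natCast {d n : ℕ} {x : Vert d} :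
    x ∈ box d (n : ℝ) ↔ ∀ i, -(n : ℤ) ≤ x i ∧ x i ≤ n := by
  have h : ⌈-(n : ℝ)⌉ = -(n : ℤ) := by
    rw [Int.ceil_neg, Int.floor_natCast]
  simp [box, h]

lemma card_box_natCast (d n : ℕ) : (box d (n : ℝ)).card = (2 * n + 1) ^ d := by
  have h : ⌈-(n : ℝ)⌉ = -(n : ℤ) := by
    rw [Int.ceil_neg, Int.floor_natCast]
  simp only [box, h, Int.floor_natCast, Fintype.card_piFinset_const, Int.card_Icc]
  congr 1
  omega

lemma card_box_pos (d n : ℕ) : (0 : ℝ) < ((box d (n : ℝ)).card : ℝ) := by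
  rw [card_box_natCast]
  positivity

lemma box_subset_box {d m n : ℕ} (h : m ≤ n) : box d (m : ℝ) ⊆ box d (n : ℝ) := by
  intro x hx
  rw [mem_box_natCast] at *
  intro i
  have := hx i
  omega

lemma tendsto_card_box_ratio (d k : ℕ) :
    Tendsto (fun n : ℕ => ((box d ((n + k : ℕ) : ℝ)).card : ℝ) / ((box d (n : ℝ)).card : ℝ))
      atTop (𝓝 1) := by
  have h1 : Tendsto (fun n : ℕ => 1 + (2 * k : ℝ) / (2 * n + 1)) atTop (𝓝 (1 + 0)) := by
    refine tendsto_const_nhds.add (Tendsto.div_atTop tendsto_const_nhds ?_)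
    refine tendsto_atTop_add_const_right _ _ ?_
    exact tendsto_natCast_atTop_atTop.const_mul_atTop (by norm_num)
  have h2 := h1.pow d
  simp only [add_zero, one_pow] at h2
  refine h2.congr fun n => ?_
  rw [card_box_natCast, card_box_natCast]
  push_cast
  rw [← div_pow]
  congr 1
  field_simp
  ring

lemma avgTo.tendsto_add {d : ℕ} {ω : EnvSp d} {F : EnvSp d → ℝ} {L : ℝ}
    (h : avgTo d ω F L) (k : ℕ) :
    Tendsto (fun n : ℕ => (∑ x ∈ box d ((n + k : ℕ) : ℝ), F (shift d x ω)) /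
      ((box d (n : ℝ)).card : ℝ)) atTop (𝓝 L) := by
  have h1 := ((tendsto_add_atTop_iff_nat k).2 h).mul (tendsto_card_box_ratio d k)
  rw [mul_one] at h1
  refine h1.congr fun n => ?_
  have := card_box_pos d n
  have := card_box_pos d (n + k)
  field_simp

lemma avgTo.add {d : ℕ} {ω : EnvSp d} {F G : EnvSp d → ℝ} {L M : ℝ}
    (h : avgTo d ω F L) (h' : avgTo d ω G M) :
    avgTo d ω (fun ω' => F ω' + G ω') (L + M) := by
  refine (Tendsto.add h h').congr fun n => ?_
  rw [Finset.sum_add_distrib, add_div]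

lemma avgTo.const_mul {d : ℕ} {ω : EnvSp d} {F : EnvSp d → ℝ} {L : ℝ}
    (h : avgTo d ω F L) (a : ℝ) :
    avgTo d ω (fun ω' => a * F ω') (a * L) := by
  refine (Tendsto.const_mul a h).congr fun n => ?_
  rw [← Finset.mul_sum, mul_div_assoc]

lemma avgTo.sum {d : ℕ} {ω : EnvSp d} {ι : Type*} (s : Finset ι) {F : ι → EnvSp d → ℝ}
    {L : ι → ℝ} (h : ∀ i ∈ s, avgTo d ω (F i) (L i)) :
    avgTo d ω (fun ω' => ∑ i ∈ s, F i ω') (∑ i ∈ s, L i) := by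
  refine (tendsto_finsetSum s h).congr fun n => ?_
  rw [Finset.sum_comm, Finset.sum_div]

end Boxes

section Law

/-- The law of an environment is invariant under translations. -/
lemma IsEnvLaw.measurePreserving {d : ℕ} {ω : EnvSp d} {P : Measure (EnvSp d)}
    (hP : IsEnvLaw d ω P) (x : Vert d) : MeasurePreserving (shift d x) P P := by
  have := hP.1
  refine ⟨measurable_shift d x, ?_⟩
  have : IsProbabilityMeasure (P.map (shift d x)) :=
    Measure.isProbabilityMeasure_map (measurable_shift d x).aemeasurable
  refine ext_of_forall_integral_eq_of_IsFiniteMeasure fun f => ?_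
  rw [integral_map (measurable_shift d x).aemeasurable f.continuous.aestronglyMeasurable]
  obtain ⟨M, hM⟩ : ∃ M, ∀ ω', |f ω'| ≤ M := ⟨‖f‖, fun ω' => f.norm_coe_le_norm ω'⟩
  have h1 := hP.2 f f.continuous ⟨M, hM⟩
  have h2 := hP.2 (fun ω' => f (shift d x ω')) (f.continuous.comp (continuous_shift d x))
    ⟨M, fun _ => hM _⟩
  obtain ⟨k, hk⟩ : ∃ k : ℕ, ∀ i, |x i| ≤ k := by
    refine ⟨∑ i, (x i).natAbs, fun i => ?_⟩
    have := Finset.single_le_sum (f := fun i => (x i).natAbs) (fun _ _ => Nat.zero_le _)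
      (Finset.mem_univ i)
    rw [Int.abs_eq_natAbs]
    exact_mod_cast this
  have hM0 : 0 ≤ M := (abs_nonneg _).trans (hM ω)
  have key : ∀ (n : ℕ) (s : Finset (Vert d)), s ⊆ box d ((n + k : ℕ) : ℝ) →
      s.card = (box d (n : ℝ)).card →
      |∑ y ∈ box d ((n + k : ℕ) : ℝ), f (shift d y ω) - ∑ y ∈ s, f (shift d y ω)| ≤
        M * (((box d ((n + k : ℕ) : ℝ)).card : ℝ) - ((box d (n : ℝ)).card : ℝ)) := by
    intro n s hs hc
    rw [← Finset.sum_sdiff hs, add_sub_cancel_right]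
    refine (Finset.abs_sum_le_sum_abs _ _).trans ?_
    refine (Finset.sum_le_card_nsmul _ _ M fun _ _ => hM _).trans ?_
    rw [Finset.card_sdiff_of_subset hs, nsmul_eq_mul, Nat.cast_sub (Finset.card_le_card hs), hc,
      mul_comm]
  refine tendsto_nhds_unique (Tendsto.congr_dist h1 ?_) h2 |>.symm ▸ rfl
  have h3 : Tendsto (fun n : ℕ => 2 * M * (((box d ((n + k : ℕ) : ℝ)).card : ℝ) /
      ((box d (n : ℝ)).card : ℝ) - 1)) atTop (𝓝 0) := by
    have := ((tendsto_card_box_ratio d k).sub_const 1).const_mul (2 * M)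
    simpa using this
  refine squeeze_zero (fun _ => dist_nonneg) (fun n => ?_) h3
  have hc := card_box_pos d n
  have e1 := key n (box d (n : ℝ)) (box_subset_box (by omega)) rfl
  have e2 := key n ((box d (n : ℝ)).map (addRightEmbedding x)) (by
    intro y hy
    obtain ⟨z, hz, rfl⟩ := Finset.mem_map.1 hy
    rw [mem_box_natCast] at *
    intro i
    have := hz i
    have := abs_le.1 (hk i)
    simp only [addRightEmbedding_apply, Pi.add_apply]
    push_cast
    omega) (Finset.card_map _)
  rw [Finset.sum_map] at e2
  simp only [addRightEmbedding_apply] at e2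
  have e3 : ∀ y, f (shift d x (shift d y ω)) = f (shift d (y + x) ω) := fun y => by
    rw [shift_shift, add_comm]
  simp only [e3]
  rw [Real.dist_eq, ← sub_div, abs_div, abs_of_pos hc, div_le_iff₀ hc]
  have e4 : 2 * M * (((box d ((n + k : ℕ) : ℝ)).card : ℝ) / ((box d (n : ℝ)).card : ℝ) - 1) *
      ((box d (n : ℝ)).card : ℝ) =
      2 * (M * (((box d ((n + k : ℕ) : ℝ)).card : ℝ) - ((box d (n : ℝ)).card : ℝ))) := by
    field_simp
  rw [e4]
  rw [abs_le] at *
  constructor <;> linarith [e1.1, e1.2, e2.1, e2.2]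

lemma IsEnvLaw.integrable_of_avg_le {d : ℕ} {ω : EnvSp d} {P : Measure (EnvSp d)}
    (hP : IsEnvLaw d ω P) {G : EnvSp d → ℝ} (hG : Continuous G) (hG0 : ∀ ω', 0 ≤ G ω') {C : ℝ}
    (hC : ∀ n : ℕ, 1 ≤ n → ∑ x ∈ box d (n : ℝ), G (shift d x ω) ≤
      C * ((box d (n : ℝ)).card : ℝ)) :
    Integrable G P ∧ ∫ ω', G ω' ∂P ≤ C := by
  have := hP.1
  have hC0 : 0 ≤ C := by
    have h1 := (Finset.sum_nonneg fun x _ => hG0 (shift d x ω)).trans (hC 1 le_rfl)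
    exact nonneg_of_mul_nonneg_left h1 (card_box_pos d 1)
  have hb : ∀ K : ℕ, ∫ ω', min (G ω') K ∂P ≤ C := by
    intro K
    have h1 := hP.2 (fun ω' => min (G ω') K) (hG.min continuous_const) ⟨K, fun ω' => by
      rw [abs_of_nonneg (le_min (hG0 _) (Nat.cast_nonneg _))]
      exact min_le_right _ _⟩
    refine le_of_tendsto h1 (eventually_atTop.2 ⟨1, fun n hn => ?_⟩)
    rw [div_le_iff₀ (card_box_pos d n)]
    exact (Finset.sum_le_sum fun x _ => min_le_left _ _).trans (hC n hn)
  have hl : ∫⁻ ω', ENNReal.ofReal (G ω') ∂P ≤ ENNReal.ofReal C := by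
    have ht : Tendsto (fun K : ℕ => ∫⁻ ω', ENNReal.ofReal (min (G ω') K) ∂P) atTop
        (𝓝 (∫⁻ ω', ENNReal.ofReal (G ω') ∂P)) := by
      refine lintegral_tendsto_of_tendsto_of_monotone (fun K => ?_) ?_ ?_
      · exact (hG.min continuous_const).measurable.ennreal_ofReal.aemeasurable
      · refine ae_of_all _ fun ω' K K' h => ENNReal.ofReal_le_ofReal ?_
        exact min_le_min le_rfl (by exact_mod_cast h)
      · refine ae_of_all _ fun ω' => tendsto_nhds_of_eventually_eq ?_
        obtain ⟨K, hK⟩ := exists_nat_ge (G ω')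
        refine eventually_atTop.2 ⟨K, fun K' h => ?_⟩
        rw [min_eq_left (hK.trans (by exact_mod_cast h))]
    refine le_of_tendsto ht (Eventually.of_forall fun K => ?_)
    rw [← ofReal_integral_eq_lintegral_ofReal]
    · exact ENNReal.ofReal_le_ofReal (hb K)
    · refine Integrable.of_bound (hG.min continuous_const).aestronglyMeasurable K
        (ae_of_all _ fun ω' => ?_)
      rw [Real.norm_eq_abs, abs_of_nonneg (le_min (hG0 _) (Nat.cast_nonneg _))]
      exact min_le_right _ _
    · exact ae_of_all _ fun ω' => le_min (hG0 _) (Nat.cast_nonneg _)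
  have hi : Integrable G P := by
    refine ⟨hG.aestronglyMeasurable, ?_⟩
    rw [hasFiniteIntegral_iff_ofReal (ae_of_all _ hG0)]
    exact hl.trans_lt ENNReal.ofReal_lt_top
  refine ⟨hi, ?_⟩
  rw [← ofReal_integral_eq_lintegral_ofReal hi (ae_of_all _ hG0)] at hl
  exact (ENNReal.ofReal_le_ofReal_iff hC0).1 hl

/-- Block averages of a continuous function with a bounded moment of order larger than one
converge to its expectation. -/
lemma IsEnvLaw.avgTo_of_moment {d : ℕ} {ω : EnvSp d} {P : Measure (EnvSp d)}
    (hP : IsEnvLaw d ω P) {F : EnvSp d → ℝ} (hF : Continuous F) {s : ℝ} (hs : 1 < s) {C : ℝ}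
    (hC : ∀ n : ℕ, 1 ≤ n → ∑ x ∈ box d (n : ℝ), |F (shift d x ω)| ^ s ≤
      C * ((box d (n : ℝ)).card : ℝ)) :
    Integrable F P ∧ avgTo d ω F (∫ ω', F ω' ∂P) := by
  have := hP.1
  have tail : ∀ M : ℝ, 0 < M → ∀ t : ℝ, max (|t| - M) 0 ≤ M ^ (1 - s) * |t| ^ s := by
    intro M hM t
    rcases le_or_gt |t| M with h | h
    · rw [max_eq_right (by linarith)]
      positivity
    · have ht : 0 < |t| := hM.trans h
      rw [max_eq_left (by linarith)]
      have h1 : |t| ^ (1 - s) ≤ M ^ (1 - s) :=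
        Real.rpow_le_rpow_of_nonpos hM h.le (by linarith)
      calc |t| - M ≤ |t| := by linarith
        _ = |t| ^ (1 - s) * |t| ^ s := by
          rw [← Real.rpow_add ht]
          simp
        _ ≤ _ := by gcongr
  have tail_avg : ∀ M : ℝ, 0 < M → ∀ n : ℕ, 1 ≤ n →
      ∑ x ∈ box d (n : ℝ), max (|F (shift d x ω)| - M) 0 ≤
        (M ^ (1 - s) * C) * ((box d (n : ℝ)).card : ℝ) := by
    intro M hM n hn
    refine (Finset.sum_le_sum fun x _ => tail M hM _).trans ?_
    rw [← Finset.mul_sum, mul_assoc]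
    exact mul_le_mul_of_nonneg_left (hC n hn) (by positivity)
  have tail_int : ∀ M : ℝ, 0 < M → Integrable (fun ω' => max (|F ω'| - M) 0) P ∧
      ∫ ω', max (|F ω'| - M) 0 ∂P ≤ M ^ (1 - s) * C := fun M hM =>
    hP.integrable_of_avg_le (by fun_prop) (fun _ => le_max_right _ _) (tail_avg M hM)
  have hFi : Integrable F P := by
    refine Integrable.mono' ((tail_int 1 one_pos).1.add (integrable_const (1 : ℝ)))
      hF.aestronglyMeasurable (ae_of_all _ fun ω' => ?_)
    have := le_max_left (|F ω'| - 1) 0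
    simp only [Pi.add_apply, Real.norm_eq_abs]
    linarith
  refine ⟨hFi, ?_⟩
  have trunc : ∀ M : ℝ, 0 < M → ∀ t : ℝ,
      |t - max (-M) (min M t)| ≤ max (|t| - M) 0 := by
    intro M hM t
    rcases le_total |t| M with h | h
    · have := abs_le.1 h
      rw [min_eq_right this.2, max_eq_right this.1]
      simp
    · rcases le_total 0 t with h0 | h0
      · rw [abs_of_nonneg h0] at *
        rw [min_eq_left h, max_eq_right (by linarith), abs_of_nonneg (by linarith)]
        exact le_max_left _ _
      · rw [abs_of_nonpos h0] at *
        rw [min_eq_right (by linarith), max_eq_left (by linarith), abs_of_nonpos (by linarith)]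
        exact le_trans (by linarith) (le_max_left _ _)
  unfold avgTo
  rw [Metric.tendsto_atTop]
  intro ε hε
  obtain ⟨M, hM, hMε⟩ : ∃ M : ℝ, 0 < M ∧ M ^ (1 - s) * C < ε / 3 := by
    have h1 : Tendsto (fun M : ℝ => M ^ (1 - s) * C) atTop (𝓝 (0 * C)) := by
      refine Tendsto.mul_const C ?_
      have := tendsto_rpow_neg_atTop (y := s - 1) (by linarith)
      simpa using this
    rw [zero_mul] at h1
    obtain ⟨M, h2, h3⟩ := ((eventually_gt_atTop (0 : ℝ)).and
      (h1.eventually (gt_mem_nhds (show 0 < ε / 3 by linarith)))).exists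
    exact ⟨M, h2, h3⟩
  have hTc : Continuous fun ω' => max (-M) (min M (F ω')) := by fun_prop
  have hTb : ∀ ω', |max (-M) (min M (F ω'))| ≤ M := fun ω' => by
    rw [abs_le]
    exact ⟨le_max_left _ _, max_le (by linarith) (min_le_left _ _)⟩
  have hT := hP.2 _ hTc ⟨M, hTb⟩
  unfold avgTo at hT
  rw [Metric.tendsto_atTop] at hT
  obtain ⟨N, hN⟩ := hT (ε / 3) (by linarith)
  refine ⟨max N 1, fun n hn => ?_⟩
  have hn1 := hN n (le_of_max_le_left hn)
  have hc := card_box_pos d n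
  have h1 : |(∑ x ∈ box d (n : ℝ), F (shift d x ω)) / ((box d (n : ℝ)).card : ℝ) -
      (∑ x ∈ box d (n : ℝ), max (-M) (min M (F (shift d x ω)))) /
        ((box d (n : ℝ)).card : ℝ)| ≤ M ^ (1 - s) * C := by
    rw [← sub_div, ← Finset.sum_sub_distrib, abs_div, abs_of_pos hc, div_le_iff₀ hc]
    exact ((Finset.abs_sum_le_sum_abs _ _).trans
      (Finset.sum_le_sum fun x _ => trunc M hM _)).trans
      (tail_avg M hM n (le_of_max_le_right hn))
  have h2 : |∫ ω', F ω' ∂P - ∫ ω', max (-M) (min M (F ω')) ∂P| ≤ M ^ (1 - s) * C := by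
    have hTi : Integrable (fun ω' => max (-M) (min M (F ω'))) P :=
      Integrable.of_bound hTc.aestronglyMeasurable M (ae_of_all _ hTb)
    rw [← integral_sub hFi hTi]
    refine (abs_integral_le_integral_abs).trans ?_
    refine (integral_mono (hFi.sub hTi).abs (tail_int M hM).1 fun ω' => ?_).trans
      (tail_int M hM).2
    exact trunc M hM _
  rw [Real.dist_eq] at *
  have e1 := abs_le.1 h1
  have e2 := abs_le.1 h2
  have e3 := abs_lt.1 hn1
  rw [abs_lt]
  constructor <;> linarith [e1.1, e1.2, e2.1, e2.2, e3.1, e3.2]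

end Law

section Ergodic

/-- Translation-invariant integrable functions are almost surely constant. -/
lemma ErgodicEnv.ae_eq_integral {d : ℕ} {P : Measure (EnvSp d)} [IsProbabilityMeasure P]
    (herg : ErgodicEnv d P) (hinv : ∀ x, MeasurePreserving (shift d x) P P)
    {f : EnvSp d → ℝ} (hf : Integrable f P)
    (hfi : ∀ x, (fun ω' => f (shift d x ω')) =ᵐ[P] f) :
    f =ᵐ[P] fun _ => ∫ ω', f ω' ∂P := by
  obtain ⟨g, hgm, hfg⟩ := hf.aestronglyMeasurable
  have hgi : ∀ x, (fun ω' => g (shift d x ω')) =ᵐ[P] g := fun x =>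
    ((hinv x).quasiMeasurePreserving.ae_eq hfg).symm.trans ((hfi x).trans hfg)
  have hall : ∀ᵐ ω' ∂P, ∀ x, g (shift d x ω') = g ω' := ae_all_iff.2 hgi
  have key : ∀ s : Set ℝ, MeasurableSet s → (∀ᵐ ω' ∂P, g ω' ∉ s) ∨ ∀ᵐ ω' ∂P, g ω' ∈ s := by
    intro s hs
    have hA : MeasurableSet {ω' | ∀ x, g (shift d x ω') ∈ s} := by
      simp only [Set.ofPred_forall]
      exact MeasurableSet.iInter fun x => (hgm.measurable.comp (measurable_shift d x)) hs
    rcases herg _ hA (fun y => by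
      ext ω'
      simp only [Set.mem_preimage, Set.mem_ofPred_eq, shift_shift]
      constructor
      · intro h x
        simpa using h (x - y)
      · intro h x
        exact h _) with h | h
    · left
      rw [measure_eq_zero_iff_ae_notMem] at h
      filter_upwards [h, hall] with ω' h1 h2 h3
      exact h1 fun x => by rwa [h2 x]
    · right
      have h' := (mem_ae_iff_prob_eq_one hA).2 h
      filter_upwards [h', hall] with ω' h1 h2
      simpa [h2] using h1 0
  have hgI : Integrable g P := hf.congr hfg
  rw [integral_congr_ae hfg]
  set m := ∫ ω', g ω' ∂P with hm
  refine hfg.trans ?_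
  have h0 : ∫ ω', (g ω' - m) ∂P = 0 := by
    rw [integral_sub hgI (integrable_const _)]
    simp [hm]
  have h0' : ∫ ω', (m - g ω') ∂P = 0 := by
    rw [integral_sub (integrable_const _) hgI]
    simp [hm]
  rcases key _ (measurableSet_Ici (a := m)) with h | h
  · rw [integral_eq_zero_iff_of_nonneg_ae ?_ (by exact (integrable_const m).sub hgI)] at h0'
    · filter_upwards [h0'] with ω' h
      simp only [Pi.zero_apply] at h
      linarith
    · filter_upwards [h] with ω' h
      simp only [Set.mem_Ici, not_le] at h
      simp only [Pi.zero_apply]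
      linarith
  · rw [integral_eq_zero_iff_of_nonneg_ae ?_ (by exact hgI.sub (integrable_const m))] at h0
    · filter_upwards [h0] with ω' h
      simp only [Pi.zero_apply] at h
      linarith
    · filter_upwards [h] with ω' h
      simp only [Set.mem_Ici] at h
      simp only [Pi.zero_apply]
      linarith

lemma memLp_comp_shift {d : ℕ} {P : Measure (EnvSp d)}
    (hinv : ∀ x, MeasurePreserving (shift d x) P P) {g : EnvSp d → ℝ} (hg : MemLp g 2 P)
    (x : Vert d) : MemLp (fun ω' => g (shift d x ω')) 2 P :=
  hg.comp_measurePreserving (hinv x)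

/-- The mean ergodic theorem in convex form: convex combinations of the translates of a centred
square-integrable function come arbitrarily close to zero. -/
lemma ErgodicEnv.exists_convex_comb_L2 {d : ℕ} {P : Measure (EnvSp d)}
    [IsProbabilityMeasure P] (herg : ErgodicEnv d P)
    (hinv : ∀ x, MeasurePreserving (shift d x) P P)
    {g : EnvSp d → ℝ} (hg : MemLp g 2 P) (hg0 : ∫ ω', g ω' ∂P = 0) {ε : ℝ} (hε : 0 < ε) :
    ∃ w : Vert d →₀ ℝ, (∀ s, 0 ≤ w s) ∧ Finsupp.linearCombination ℝ (fun _ => (1 : ℝ)) w = 1 ∧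
      ‖Finsupp.linearCombination ℝ (fun s => (memLp_comp_shift hinv hg s).toLp) w‖ < ε := by
  set φ : Vert d → Lp ℝ 2 P := fun s => (memLp_comp_shift hinv hg s).toLp with hφ
  set U : Vert d → Lp ℝ 2 P →ₗᵢ[ℝ] Lp ℝ 2 P := fun x =>
    Lp.compMeasurePreservingₗᵢ ℝ (shift d x) (hinv x) with hU
  have hUφ : ∀ x s, U x (φ s) = φ (s + x) := by
    intro x s
    have h1 : U x (φ s) = ((memLp_comp_shift hinv hg s).comp_measurePreserving (hinv x)).toLp :=
      Lp.toLp_compMeasurePreserving _ _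
    rw [h1]
    refine (MemLp.toLp_eq_toLp_iff _ _).2 (ae_of_all _ fun ω' => ?_)
    simp [shift_shift]
  set D : Set (Lp ℝ 2 P) := {z | ∃ w : Vert d →₀ ℝ, (∀ s, 0 ≤ w s) ∧
    Finsupp.linearCombination ℝ (fun _ => (1 : ℝ)) w = 1 ∧
      Finsupp.linearCombination ℝ φ w = z} with hD
  have hDconv : Convex ℝ D := by
    rintro z ⟨w, h1, h2, h3⟩ z' ⟨w', h1', h2', h3'⟩ a b ha hb hab
    refine ⟨a • w + b • w', fun s => ?_, ?_, ?_⟩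
    · simpa using add_nonneg (mul_nonneg ha (h1 s)) (mul_nonneg hb (h1' s))
    · rw [map_add, map_smul, map_smul, h2, h2']
      simpa using hab
    · rw [map_add, map_smul, map_smul, h3, h3']
  have hDne : D.Nonempty := by
    refine ⟨φ 0, Finsupp.single 0 1, fun s => ?_, ?_, ?_⟩
    · rw [Finsupp.single_apply]
      split_ifs <;> norm_num
    · simp
    · simp
  have hDU : ∀ x, ∀ z ∈ D, U x z ∈ D := by
    rintro x z ⟨w, h1, h2, h3⟩
    refine ⟨w.embDomain (addRightEmbedding x), fun s => ?_, ?_, ?_⟩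
    · by_cases h : s ∈ Set.range (addRightEmbedding x)
      · obtain ⟨s', rfl⟩ := h
        rw [Finsupp.embDomain_apply_self]
        exact h1 s'
      · rw [Finsupp.embDomain_of_notMem_range _ _ _ h]
    · rw [Finsupp.linearCombination_embDomain]
      exact h2
    · rw [Finsupp.linearCombination_embDomain, ← h3]
      have : (U x).toLinearMap (Finsupp.linearCombination ℝ φ w) =
          Finsupp.linearCombination ℝ (fun s => φ (s + x)) w := by
        rw [Finsupp.apply_linearCombination]
        congr 2
        ext1 s
        exact hUφ x s
      exact this.symm
  set e : Lp ℝ 2 P := indicatorConstLp 2 MeasurableSet.univ (measure_ne_top P _) (1 : ℝ) with he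
  have hinner : ∀ z : Lp ℝ 2 P, inner ℝ e z = ∫ ω', z ω' ∂P := fun z => by
    rw [he, L2.inner_indicatorConstLp_one, setIntegral_univ]
  have hφ0 : ∀ s, inner ℝ e (φ s) = 0 := by
    intro s
    rw [hinner, integral_congr_ae (memLp_comp_shift hinv hg s).coeFn_toLp]
    have hm : AEStronglyMeasurable g (P.map (shift d s)) := by
      rw [(hinv s).map_eq]
      exact hg.aestronglyMeasurable
    rw [← integral_map (hinv s).measurable.aemeasurable hm, (hinv s).map_eq]
    exact hg0
  have hDint : ∀ z ∈ closure D, inner ℝ e z = 0 := by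
    have hcl : IsClosed {z : Lp ℝ 2 P | inner ℝ e z = 0} :=
      isClosed_eq (by fun_prop) continuous_const
    refine fun z hz => closure_minimal ?_ hcl hz
    rintro z ⟨w, h1, h2, rfl⟩
    rw [Set.mem_ofPred_eq, Finsupp.linearCombination_apply, Finsupp.inner_sum]
    simp [inner_smul_right, hφ0]
  obtain ⟨m, hmD, hm⟩ := exists_norm_eq_iInf_of_complete_convex hDne.closure
    isClosed_closure.isComplete hDconv.closure (0 : Lp ℝ 2 P)
  rw [norm_eq_iInf_iff_real_inner_le_zero hDconv.closure hmD] at hm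
  have hUm : ∀ x, U x m = m := by
    intro x
    have hx : U x m ∈ closure D :=
      map_mem_closure (U x).continuous hmD (hDU x)
    have h1 := hm _ hx
    rw [zero_sub, inner_neg_left, inner_sub_right, real_inner_self_eq_norm_sq] at h1
    have h2 := norm_sub_sq_real (U x m) m
    rw [(U x).norm_map, real_inner_comm] at h2
    have h3 : ‖U x m - m‖ ^ 2 ≤ 0 := by linarith
    have h4 : ‖U x m - m‖ = 0 := by
      have := sq_nonneg ‖U x m - m‖
      exact pow_eq_zero_iff two_ne_zero |>.1 (le_antisymm h3 this)
    exact sub_eq_zero.1 (norm_eq_zero.1 h4)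
  have hmc : m =ᵐ[P] fun _ => ∫ ω', m ω' ∂P := by
    refine herg.ae_eq_integral hinv ((Lp.memLp m).integrable (by norm_num)) fun x => ?_
    have h1 := Lp.coeFn_compMeasurePreserving m (hinv x)
    have h2 : Lp.compMeasurePreserving (shift d x) (hinv x) m = m := hUm x
    rw [h2] at h1
    exact h1.symm
  rw [← hinner, hDint m hmD] at hmc
  have hm0 : m = 0 := by
    refine Lp.ext (hmc.trans ?_)
    exact (Lp.coeFn_zero ℝ 2 P).symm
  rw [hm0] at hmD
  obtain ⟨z, ⟨w, h1, h2, h3⟩, hz⟩ := Metric.mem_closure_iff.1 hmD ε hε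
  refine ⟨w, h1, h2, ?_⟩
  rw [h3]
  rwa [dist_zero_left] at hz

lemma integral_comp_shift {d : ℕ} {P : Measure (EnvSp d)}
    (hinv : ∀ x, MeasurePreserving (shift d x) P P) {f : EnvSp d → ℝ}
    (hf : AEStronglyMeasurable f P) (x : Vert d) :
    ∫ ω', f (shift d x ω') ∂P = ∫ ω', f ω' ∂P := by
  have hm : AEStronglyMeasurable f (P.map (shift d x)) := by rwa [(hinv x).map_eq]
  rw [← integral_map (hinv x).measurable.aemeasurable hm, (hinv x).map_eq]

lemma integrable_comp_shift {d : ℕ} {P : Measure (EnvSp d)}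
    (hinv : ∀ x, MeasurePreserving (shift d x) P P) {f : EnvSp d → ℝ}
    (hf : Integrable f P) (x : Vert d) : Integrable (fun ω' => f (shift d x ω')) P :=
  (hinv x).integrable_comp_of_integrable hf

lemma ErgodicEnv.exists_convex_comb_L1 {d : ℕ} {P : Measure (EnvSp d)}
    [IsProbabilityMeasure P] (herg : ErgodicEnv d P)
    (hinv : ∀ x, MeasurePreserving (shift d x) P P)
    {f : EnvSp d → ℝ} (hf : Integrable f P) (hf0 : ∫ ω', f ω' ∂P = 0) {ε : ℝ} (hε : 0 < ε) :
    ∃ w : Vert d →₀ ℝ, (∑ s ∈ w.support, w s = 1) ∧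
      ∫ ω', |∑ s ∈ w.support, w s * f (shift d s ω')| ∂P ≤ ε := by
  obtain ⟨g₀, hg₀, hg₀i⟩ := hf.exists_boundedContinuous_integral_sub_le
    (show 0 < ε / 3 by linarith)
  set m := ∫ ω', g₀ ω' ∂P with hm
  have hm' : |m| ≤ ε / 3 := by
    have hm₁ : m = ∫ ω', (g₀ ω' - f ω') ∂P := by
      rw [integral_sub hg₀i hf, hf0, sub_zero]
    rw [hm₁]
    refine abs_integral_le_integral_abs.trans (le_trans (le_of_eq ?_) hg₀)
    refine integral_congr_ae (ae_of_all _ fun ω' => ?_)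
    simp only [Real.norm_eq_abs]
    exact abs_sub_comm _ _
  have hgL : MemLp (fun ω' => g₀ ω' - m) 2 P := by
    refine MemLp.of_bound (hg₀i.aestronglyMeasurable.sub aestronglyMeasurable_const)
      (‖g₀‖ + |m|) (ae_of_all _ fun ω' => ?_)
    exact (norm_sub_le _ _).trans (add_le_add (g₀.norm_coe_le_norm ω') le_rfl)
  have hgi : Integrable (fun ω' => g₀ ω' - m) P := hg₀i.sub (integrable_const _)
  have hfg : Integrable (fun ω' => f ω' - (g₀ ω' - m)) P := hf.sub hgi
  have hfgn : ∫ ω', |f ω' - (g₀ ω' - m)| ∂P ≤ ε / 3 + ε / 3 := by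
    calc ∫ ω', |f ω' - (g₀ ω' - m)| ∂P ≤ ∫ ω', (‖f ω' - g₀ ω'‖ + |m|) ∂P := by
          refine integral_mono hfg.abs ((hf.sub hg₀i).norm.add (integrable_const _)) fun ω' => ?_
          simp only [Real.norm_eq_abs]
          rw [show f ω' - (g₀ ω' - m) = f ω' - g₀ ω' + m by ring]
          exact abs_add_le _ _
      _ = ∫ ω', ‖f ω' - g₀ ω'‖ ∂P + |m| := by
          rw [integral_add (by exact (hf.sub hg₀i).norm) (integrable_const _)]
          simp
      _ ≤ _ := add_le_add hg₀ hm'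
  obtain ⟨w, h1, h2, h3⟩ := herg.exists_convex_comb_L2 hinv hgL (by
    rw [integral_sub hg₀i (integrable_const _)]
    simp [hm]) (show 0 < ε / 3 by linarith)
  have hw1 : ∑ s ∈ w.support, w s = 1 := by
    simpa [Finsupp.linearCombination_apply, Finsupp.sum] using h2
  refine ⟨w, hw1, ?_⟩
  have h4 : ∫ ω', |∑ s ∈ w.support, w s * (g₀ (shift d s ω') - m)| ∂P ≤ ε / 3 := by
    set z := Finsupp.linearCombination ℝ (fun s => (memLp_comp_shift hinv hgL s).toLp) w with hz
    have hze : z =ᵐ[P] fun ω' => ∑ s ∈ w.support, w s * (g₀ (shift d s ω') - m) := by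
      rw [hz, Finsupp.linearCombination_apply, Finsupp.sum]
      refine (Lp.coeFn_finsetSum _ _).trans ?_
      have : ∀ᵐ ω' ∂P, ∀ s, (w s • (memLp_comp_shift hinv hgL s).toLp : Lp ℝ 2 P) ω' =
          w s * (g₀ (shift d s ω') - m) := by
        refine ae_all_iff.2 fun s => ?_
        filter_upwards [Lp.coeFn_smul (w s) ((memLp_comp_shift hinv hgL s).toLp),
          (memLp_comp_shift hinv hgL s).coeFn_toLp] with ω' e1 e2
        rw [e1, Pi.smul_apply, e2, smul_eq_mul]
      filter_upwards [this] with ω' h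
      rw [Finset.sum_apply]
      exact Finset.sum_congr rfl fun s _ => h s
    have hzi : Integrable z P := (Lp.memLp z).integrable (by norm_num)
    calc ∫ ω', |∑ s ∈ w.support, w s * (g₀ (shift d s ω') - m)| ∂P = ∫ ω', ‖z ω'‖ ∂P := by
          refine integral_congr_ae (hze.mono fun ω' h => ?_)
          simp only [h, Real.norm_eq_abs]
      _ = (eLpNorm z 1 P).toReal := by
          rw [integral_norm_eq_lintegral_enorm hzi.aestronglyMeasurable,
            eLpNorm_one_eq_lintegral_enorm]
      _ ≤ (eLpNorm z 2 P).toReal := by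
          refine ENNReal.toReal_mono (Lp.memLp z).eLpNorm_ne_top ?_
          exact eLpNorm_le_eLpNorm_of_exponent_le (by norm_num) (Lp.aestronglyMeasurable z)
      _ = ‖z‖ := (Lp.norm_def z).symm
      _ ≤ ε / 3 := h3.le
  have hi1 : Integrable (fun ω' => |∑ s ∈ w.support, w s * (g₀ (shift d s ω') - m)|) P :=
    (integrable_finsetSum _ fun s _ => (integrable_comp_shift hinv hgi s).const_mul _).abs
  have hi2 : Integrable (fun ω' => ∑ s ∈ w.support, w s *
      |f (shift d s ω') - (g₀ (shift d s ω') - m)|) P :=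
    integrable_finsetSum _ fun s _ => ((integrable_comp_shift hinv hfg s).abs).const_mul _
  calc ∫ ω', |∑ s ∈ w.support, w s * f (shift d s ω')| ∂P
      ≤ ∫ ω', (|∑ s ∈ w.support, w s * (g₀ (shift d s ω') - m)| + ∑ s ∈ w.support, w s *
          |f (shift d s ω') - (g₀ (shift d s ω') - m)|) ∂P := by
        refine integral_mono (integrable_finsetSum _ fun s _ =>
          (integrable_comp_shift hinv hf s).const_mul _).abs (hi1.add hi2) fun ω' => ?_
        have e1 : ∑ s ∈ w.support, w s * f (shift d s ω') =
            ∑ s ∈ w.support, w s * (g₀ (shift d s ω') - m) +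
            ∑ s ∈ w.support, w s * (f (shift d s ω') - (g₀ (shift d s ω') - m)) := by
          rw [← Finset.sum_add_distrib]
          exact Finset.sum_congr rfl fun s _ => by ring
        simp only [e1]
        refine (abs_add_le _ _).trans (add_le_add le_rfl ?_)
        refine (Finset.abs_sum_le_sum_abs _ _).trans (Finset.sum_le_sum fun s _ => ?_)
        rw [abs_mul, abs_of_nonneg (h1 s)]
    _ = ∫ ω', |∑ s ∈ w.support, w s * (g₀ (shift d s ω') - m)| ∂P +
        ∑ s ∈ w.support, w s * ∫ ω', |f ω' - (g₀ ω' - m)| ∂P := by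
        rw [integral_add hi1 hi2, integral_finsetSum _ fun s _ =>
          ((integrable_comp_shift hinv hfg s).abs).const_mul _]
        congr 1
        refine Finset.sum_congr rfl fun s _ => ?_
        rw [integral_const_mul]
        congr 1
        exact integral_comp_shift hinv hfg.abs.aestronglyMeasurable s
    _ ≤ ε / 3 + 1 * (ε / 3 + ε / 3) := by
        rw [← Finset.sum_mul, hw1]
        gcongr
    _ = ε := by ring

end Ergodic

section Lattice

lemma eq_sum_zsmul_unitv {d : ℕ} (x : Vert d) : x = ∑ i, x i • unitv d i := by
  ext j
  simp [unitv, Finset.sum_apply]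

lemma mem_of_unitv_mem {d : ℕ} {H : AddSubgroup (Vert d)} (h : ∀ i, unitv d i ∈ H)
    (x : Vert d) : x ∈ H := by
  rw [eq_sum_zsmul_unitv x]
  exact H.sum_mem fun i _ => H.zsmul_mem (h i) _

lemma add_unitv_mem_box {d n : ℕ} {x : Vert d} (hx : x ∈ box d (n : ℝ)) (i : Fin d) :
    x + unitv d i ∈ box d ((n + 1 : ℕ) : ℝ) := by
  rw [mem_box_natCast] at *
  intro j
  have := hx j
  simp only [Pi.add_apply, unitv]
  push_cast
  split_ifs <;> omega

lemma sub_unitv_mem_box {d n : ℕ} {x : Vert d} (hx : x ∈ box d (n : ℝ)) (i : Fin d) :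
    x - unitv d i ∈ box d ((n + 1 : ℕ) : ℝ) := by
  rw [mem_box_natCast] at *
  intro j
  have := hx j
  simp only [Pi.sub_apply, unitv]
  push_cast
  split_ifs <;> omega

lemma sum_box_sub_unitv {d n : ℕ} {h : Vert d → ℝ} (hh : ∀ x ∉ box d (n : ℝ), h x = 0)
    (g : Vert d → Vert d → ℝ) (i : Fin d) :
    ∑ x ∈ box d (n : ℝ), h x * g x (x - unitv d i) =
      ∑ y ∈ box d ((n + 1 : ℕ) : ℝ), h (y + unitv d i) * g (y + unitv d i) y := by
  have h1 : ∑ x ∈ box d (n : ℝ), h x * g x (x - unitv d i) =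
      ∑ x ∈ (box d ((n + 1 : ℕ) : ℝ)).map (addRightEmbedding (unitv d i)),
        h x * g x (x - unitv d i) := by
    refine Finset.sum_subset (fun x hx => ?_) fun x _ hx => by rw [hh x hx, zero_mul]
    refine Finset.mem_map.2 ⟨x - unitv d i, sub_unitv_mem_box hx i, ?_⟩
    simp
  rw [h1, Finset.sum_map]
  simp

lemma sum_box_succ {d n : ℕ} {h : Vert d → ℝ} (hh : ∀ x ∉ box d (n : ℝ), h x = 0)
    (g : Vert d → ℝ) :
    ∑ x ∈ box d (n : ℝ), h x * g x = ∑ y ∈ box d ((n + 1 : ℕ) : ℝ), h y * g y :=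
  Finset.sum_subset (box_subset_box (by omega)) fun x _ hx => by rw [hh x hx, zero_mul]

/-- Summation by parts on a box. -/
lemma sum_box_mul_div {d n : ℕ} {h : Vert d → ℝ} (hh : ∀ x ∉ box d (n : ℝ), h x = 0)
    (A : Vert d → Fin d → ℝ) :
    ∑ x ∈ box d (n : ℝ), h x * ∑ i, (A x i - A (x - unitv d i) i) =
      -∑ y ∈ box d ((n + 1 : ℕ) : ℝ), ∑ i, A y i * (h (y + unitv d i) - h y) := by
  simp only [Finset.mul_sum]
  rw [Finset.sum_comm, Finset.sum_comm (s := box d ((n + 1 : ℕ) : ℝ)), ← Finset.sum_neg_distrib]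
  refine Finset.sum_congr rfl fun i _ => ?_
  simp only [mul_sub, Finset.sum_sub_distrib]
  rw [sum_box_succ hh fun x => A x i, sum_box_sub_unitv hh (fun _ y => A y i) i]
  simp only [mul_comm]
  ring

/-- The boundary of a chain of lattice edges. -/
def chainBd (d : ℕ) : (EdgeIx d →₀ ℝ) →ₗ[ℝ] (Vert d →₀ ℝ) :=
  Finsupp.linearCombination ℝ fun e =>
    Finsupp.single e.1 (1 : ℝ) - Finsupp.single (e.1 + unitv d e.2) (1 : ℝ)

lemma exists_chain {d : ℕ} (x : Vert d) :
    ∃ l : EdgeIx d →₀ ℝ, chainBd d l = Finsupp.single 0 (1 : ℝ) - Finsupp.single x (1 : ℝ) := by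
  let H : AddSubgroup (Vert d) :=
    { carrier := {y | ∀ x, Finsupp.single x (1 : ℝ) - Finsupp.single (x + y) (1 : ℝ) ∈
        LinearMap.range (chainBd d)}
      zero_mem' := fun x => by simp
      add_mem' := fun {y z} hy hz x => by
        have := Submodule.add_mem _ (hy x) (hz (x + y))
        rwa [sub_add_sub_cancel, add_assoc] at this
      neg_mem' := fun {y} hy x => by
        have := Submodule.neg_mem _ (hy (x + -y))
        rwa [neg_sub, neg_add_cancel_right] at this }
  have hx : x ∈ H := by
    refine mem_of_unitv_mem (fun i y => ?_) x
    exact ⟨Finsupp.single (y, i) 1, by simp [chainBd]⟩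
  simpa using hx 0

/-- The translation of a chain of lattice edges. -/
def chainShift (d : ℕ) (x : Vert d) : (EdgeIx d →₀ ℝ) →ₗ[ℝ] (EdgeIx d →₀ ℝ) :=
  Finsupp.lmapDomain ℝ ℝ fun e => (e.1 + x, e.2)

lemma chainBd_chainShift {d : ℕ} (x : Vert d) (l : EdgeIx d →₀ ℝ) :
    chainBd d (chainShift d x l) =
      Finsupp.lmapDomain ℝ ℝ (fun y => y + x) (chainBd d l) := by
  have : (chainBd d).comp (chainShift d x) =
      (Finsupp.lmapDomain ℝ ℝ (fun y : Vert d => y + x)).comp (chainBd d) := by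
    refine Finsupp.lhom_ext' fun e => LinearMap.ext_ring ?_
    simp only [chainBd, chainShift, LinearMap.comp_apply, Finsupp.lsingle_apply,
      Finsupp.lmapDomain_apply, Finsupp.mapDomain_single, Finsupp.linearCombination_single,
      one_smul, map_sub]
    rw [add_right_comm]
  exact LinearMap.congr_fun this l

/-- The pairing of a chain with the translates of a vector field on `Ω`. -/
def chainPair (d : ℕ) (b : EnvSp d → Fin d → ℝ) (ω : EnvSp d) : (EdgeIx d →₀ ℝ) →ₗ[ℝ] ℝ :=
  Finsupp.linearCombination ℝ fun e => b (shift d e.1 ω) e.2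

lemma chainPair_chainShift {d : ℕ} (b : EnvSp d → Fin d → ℝ) (ω : EnvSp d) (x : Vert d)
    (l : EdgeIx d →₀ ℝ) :
    chainPair d b ω (chainShift d x l) = chainPair d b (shift d x ω) l := by
  have : (chainPair d b ω).comp (chainShift d x) = chainPair d b (shift d x ω) := by
    refine Finsupp.lhom_ext' fun e => LinearMap.ext_ring ?_
    simp [chainPair, chainShift, shift_shift]
  exact LinearMap.congr_fun this l

lemma chainPair_eq_sum {d : ℕ} (b : EnvSp d → Fin d → ℝ) (ω : EnvSp d) (l : EdgeIx d →₀ ℝ) :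
    chainPair d b ω l = ∑ e ∈ l.support, l e * b (shift d e.1 ω) e.2 := by
  simp [chainPair, Finsupp.linearCombination_apply, Finsupp.sum]

end Lattice

section Cocycle

/-- A stationary field whose pairing with every cycle vanishes is the gradient of a cocycle. -/
lemma exists_cocycle {d : ℕ} {P : Measure (EnvSp d)}
    (hinv : ∀ x, MeasurePreserving (shift d x) P P) {b : EnvSp d → Fin d → ℝ}
    (hbi : ∀ i, Integrable (fun ω' => b ω' i) P)
    (hloop : ∀ l : EdgeIx d →₀ ℝ, chainBd d l = 0 → ∀ᵐ ω' ∂P, chainPair d b ω' l = 0) :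
    ∃ χ : Vert d → EnvSp d → ℝ, (∀ x, Integrable (χ x) P) ∧
      (∀ x y, ∀ᵐ ω' ∂P, χ (x + y) ω' = χ x ω' + χ y (shift d x ω')) ∧
      ∀ i, ∀ᵐ ω' ∂P, χ (unitv d i) ω' = b ω' i := by
  choose l hl using exists_chain (d := d)
  refine ⟨fun x ω' => chainPair d b ω' (l x), fun x => ?_, fun x y => ?_, fun i => ?_⟩
  · simp only [chainPair_eq_sum]
    exact integrable_finsetSum _ fun e _ =>
      (integrable_comp_shift hinv (hbi e.2) e.1).const_mul _
  · have := hloop (l (x + y) - l x - chainShift d x (l y)) (by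
      rw [map_sub, map_sub, chainBd_chainShift, hl, hl, hl, map_sub]
      simp only [Finsupp.lmapDomain_apply, Finsupp.mapDomain_single, zero_add]
      rw [add_comm y x]
      abel)
    filter_upwards [this] with ω' h
    rw [map_sub, map_sub, chainPair_chainShift] at h
    linarith
  · have := hloop (l (unitv d i) - Finsupp.single (0, i) 1) (by
      rw [map_sub, hl]
      simp [chainBd])
    filter_upwards [this] with ω' h
    rw [map_sub] at h
    simp only [chainPair, Finsupp.linearCombination_single, shift_zero, one_smul] at h ⊢
    linarith

variable {d : ℕ} {P : Measure (EnvSp d)} {χ : Vert d → EnvSp d → ℝ}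

lemma cocycle_norm_add_le (hinv : ∀ x, MeasurePreserving (shift d x) P P)
    (hχi : ∀ x, Integrable (χ x) P)
    (hχ : ∀ x y, ∀ᵐ ω' ∂P, χ (x + y) ω' = χ x ω' + χ y (shift d x ω')) (x y : Vert d) :
    ∫ ω', |χ (x + y) ω'| ∂P ≤ ∫ ω', |χ x ω'| ∂P + ∫ ω', |χ y ω'| ∂P := by
  have h1 := integrable_comp_shift hinv (hχi y) x
  calc ∫ ω', |χ (x + y) ω'| ∂P ≤ ∫ ω', (|χ x ω'| + |χ y (shift d x ω')|) ∂P := by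
        refine integral_mono_ae (hχi _).abs ((hχi x).abs.add h1.abs) ?_
        filter_upwards [hχ x y] with ω' h
        rw [h]
        exact abs_add_le _ _
    _ = ∫ ω', |χ x ω'| ∂P + ∫ ω', |χ y (shift d x ω')| ∂P :=
        integral_add (hχi x).abs h1.abs
    _ = _ := by rw [integral_comp_shift hinv (hχi y).abs.aestronglyMeasurable x]

lemma cocycle_zero (hχ : ∀ x y, ∀ᵐ ω' ∂P, χ (x + y) ω' = χ x ω' + χ y (shift d x ω')) :
    χ 0 =ᵐ[P] 0 := by
  filter_upwards [hχ 0 0] with ω' h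
  rw [shift_zero, add_zero] at h
  simpa using h

lemma cocycle_norm_neg_le (hinv : ∀ x, MeasurePreserving (shift d x) P P)
    (hχi : ∀ x, Integrable (χ x) P)
    (hχ : ∀ x y, ∀ᵐ ω' ∂P, χ (x + y) ω' = χ x ω' + χ y (shift d x ω')) (x : Vert d) :
    ∫ ω', |χ (-x) ω'| ∂P ≤ ∫ ω', |χ x ω'| ∂P := by
  rw [← integral_comp_shift hinv (hχi x).abs.aestronglyMeasurable (-x)]
  refine (integral_congr_ae ?_).le
  filter_upwards [hχ (-x) x, cocycle_zero hχ] with ω' h1 h2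
  rw [neg_add_cancel, h2, Pi.zero_apply] at h1
  rw [show χ (-x) ω' = -χ x (shift d (-x) ω') by linarith, abs_neg]

lemma cocycle_norm_nsmul_le (hinv : ∀ x, MeasurePreserving (shift d x) P P)
    (hχi : ∀ x, Integrable (χ x) P)
    (hχ : ∀ x y, ∀ᵐ ω' ∂P, χ (x + y) ω' = χ x ω' + χ y (shift d x ω')) (x : Vert d) (n : ℕ) :
    ∫ ω', |χ (n • x) ω'| ∂P ≤ n * ∫ ω', |χ x ω'| ∂P := by
  induction n with
  | zero =>
    rw [zero_smul, integral_congr_ae (g := fun _ => 0) ((cocycle_zero hχ).mono fun ω' h => by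
      simp [h])]
    simp
  | succ n ih =>
    rw [succ_nsmul]
    refine (cocycle_norm_add_le hinv hχi hχ _ _).trans ?_
    push_cast
    linarith

/-- Cocycles with centred increments grow sublinearly in mean along coordinate directions. -/
lemma cocycle_sublinear_unitv [IsProbabilityMeasure P] (herg : ErgodicEnv d P)
    (hinv : ∀ x, MeasurePreserving (shift d x) P P) (hχi : ∀ x, Integrable (χ x) P)
    (hχ : ∀ x y, ∀ᵐ ω' ∂P, χ (x + y) ω' = χ x ω' + χ y (shift d x ω')) (e : Vert d)
    (h0 : ∫ ω', χ e ω' ∂P = 0) {ε : ℝ} (hε : 0 < ε) :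
    ∃ C, 0 ≤ C ∧ ∀ n : ℕ, ∫ ω', |χ (n • e) ω'| ∂P ≤ ε * n + C := by
  obtain ⟨w, hw1, hw2⟩ := herg.exists_convex_comb_L1 hinv (hχi e) h0 hε
  set ψ : Vert d → EnvSp d → ℝ := fun x ω' => ∑ s ∈ w.support, w s * χ x (shift d s ω') with hψ
  have hψi : ∀ x, Integrable (ψ x) P := fun x =>
    integrable_finsetSum _ fun s _ => (integrable_comp_shift hinv (hχi x) s).const_mul _
  have hψc : ∀ x y, ∀ᵐ ω' ∂P, ψ (x + y) ω' = ψ x ω' + ψ y (shift d x ω') := by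
    intro x y
    have h1 : ∀ᵐ ω' ∂P, ∀ s, χ (x + y) (shift d s ω') =
        χ x (shift d s ω') + χ y (shift d x (shift d s ω')) :=
      ae_all_iff.2 fun s => (hinv s).quasiMeasurePreserving.ae (hχ x y)
    filter_upwards [h1] with ω' h
    simp only [hψ, h, mul_add, Finset.sum_add_distrib, shift_shift]
    simp only [add_comm x]
  have hψn := fun n => cocycle_norm_nsmul_le hinv hψi hψc e n
  refine ⟨2 * ∑ s ∈ w.support, |w s| * ∫ ω', |χ s ω'| ∂P, ?_, fun n => ?_⟩
  · exact mul_nonneg zero_le_two (Finset.sum_nonneg fun s _ =>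
      mul_nonneg (abs_nonneg _) (integral_nonneg fun _ => abs_nonneg _))
  set x := n • e
  have hcomm : ∀ᵐ ω' ∂P, ∀ s, χ x ω' = χ x (shift d s ω') - χ s (shift d x ω') + χ s ω' := by
    refine ae_all_iff.2 fun s => ?_
    filter_upwards [hχ x s, hχ s x] with ω' h1 h2
    rw [add_comm] at h1
    linarith
  have hr : ∀ s, Integrable (fun ω' => |w s| * (|χ s (shift d x ω')| + |χ s ω'|)) P := fun s =>
    ((integrable_comp_shift hinv (hχi s) x).abs.add (hχi s).abs).const_mul _
  calc ∫ ω', |χ x ω'| ∂P ≤ ∫ ω', (|ψ x ω'| + ∑ s ∈ w.support,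
        |w s| * (|χ s (shift d x ω')| + |χ s ω'|)) ∂P := by
        refine integral_mono_ae (hχi x).abs
          ((hψi x).abs.add (integrable_finsetSum _ fun s _ => hr s)) ?_
        filter_upwards [hcomm] with ω' h
        have h1 : χ x ω' = ψ x ω' + ∑ s ∈ w.support, w s * (χ s ω' - χ s (shift d x ω')) := by
          calc χ x ω' = ∑ s ∈ w.support, w s * χ x ω' := by
                rw [← Finset.sum_mul, hw1, one_mul]
            _ = ∑ s ∈ w.support, (w s * χ x (shift d s ω') +
                  w s * (χ s ω' - χ s (shift d x ω'))) := by
                refine Finset.sum_congr rfl fun s _ => ?_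
                rw [h s]
                have := h s
                have e1 : χ x (shift d s ω') - χ s (shift d x ω') + χ s ω' = χ x ω' := this.symm
                ring
            _ = _ := Finset.sum_add_distrib
        rw [h1]
        refine (abs_add_le _ _).trans (add_le_add le_rfl ?_)
        refine (Finset.abs_sum_le_sum_abs _ _).trans (Finset.sum_le_sum fun s _ => ?_)
        rw [abs_mul, add_comm]
        exact mul_le_mul_of_nonneg_left (abs_sub _ _) (abs_nonneg _)
    _ = ∫ ω', |ψ x ω'| ∂P + 2 * ∑ s ∈ w.support, |w s| * ∫ ω', |χ s ω'| ∂P := by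
        rw [integral_add (hψi x).abs (integrable_finsetSum _ fun s _ => hr s),
          integral_finsetSum _ fun s _ => hr s, Finset.mul_sum]
        congr 1
        refine Finset.sum_congr rfl fun s _ => ?_
        rw [integral_const_mul, integral_add (integrable_comp_shift hinv (hχi s) x).abs
          (hχi s).abs, integral_comp_shift hinv (hχi s).abs.aestronglyMeasurable x]
        ring
    _ ≤ ε * n + 2 * ∑ s ∈ w.support, |w s| * ∫ ω', |χ s ω'| ∂P := by
        gcongr
        refine (hψn n).trans ?_
        rw [mul_comm]
        exact mul_le_mul_of_nonneg_right hw2 (Nat.cast_nonneg _)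

/-- Cocycles with centred increments are sublinear in mean. -/
lemma cocycle_sublinear [IsProbabilityMeasure P] (herg : ErgodicEnv d P)
    (hinv : ∀ x, MeasurePreserving (shift d x) P P) (hχi : ∀ x, Integrable (χ x) P)
    (hχ : ∀ x y, ∀ᵐ ω' ∂P, χ (x + y) ω' = χ x ω' + χ y (shift d x ω'))
    (h0 : ∀ i, ∫ ω', χ (unitv d i) ω' ∂P = 0) {ε : ℝ} (hε : 0 < ε) :
    ∃ C, ∀ n : ℕ, ∀ x ∈ box d (n : ℝ), ∫ ω', |χ x ω'| ∂P ≤ ε * n + C := by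
  have hd : (0 : ℝ) < d + 1 := by positivity
  choose C hC0 hC using fun i => cocycle_sublinear_unitv herg hinv hχi hχ (unitv d i) (h0 i)
    (div_pos hε hd)
  refine ⟨∑ i, C i, fun n x hx => ?_⟩
  have hsum : ∀ s : Finset (Fin d), ∫ ω', |χ (∑ i ∈ s, x i • unitv d i) ω'| ∂P ≤
      ∑ i ∈ s, (ε / (d + 1) * n + C i) := by
    intro s
    induction s using Finset.induction_on with
    | empty =>
      rw [Finset.sum_empty, integral_congr_ae (g := fun _ => 0)
        ((cocycle_zero hχ).mono fun ω' h => by simp [h])]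
      simp
    | insert i s hi ih =>
      rw [Finset.sum_insert hi, Finset.sum_insert hi]
      refine (cocycle_norm_add_le hinv hχi hχ _ _).trans (add_le_add ?_ ih)
      have h1 : ∀ m : ℕ, m ≤ n → ∫ ω', |χ (m • unitv d i) ω'| ∂P ≤ ε / (d + 1) * n + C i := by
        intro m hm
        refine (hC i m).trans ?_
        gcongr
      have hxi := mem_box_natCast.1 hx i
      rcases Int.eq_nat_or_neg (x i) with ⟨m, hm | hm⟩
      · rw [hm, natCast_zsmul]
        exact h1 m (by omega)
      · rw [hm, neg_smul, natCast_zsmul]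
        exact (cocycle_norm_neg_le hinv hχi hχ _).trans (h1 m (by omega))
  have h2 := hsum Finset.univ
  rw [← eq_sum_zsmul_unitv x, Finset.sum_add_distrib] at h2
  refine h2.trans (add_le_add ?_ le_rfl)
  rw [Finset.sum_const, Finset.card_univ, Fintype.card_fin, nsmul_eq_mul]
  have : (d : ℝ) * (ε / (d + 1) * n) = ε * n * (d / (d + 1)) := by ring
  rw [this]
  refine mul_le_of_le_one_right (by positivity) ?_
  rw [div_le_one hd]
  linarith

end Cocycle

section Rigidity

/-- The piecewise linear cutoff equal to `1` on `box d n` and vanishing off `box d (2 * n)`. -/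
def cutoff (d n : ℕ) (x : Vert d) : ℝ := max 0 (min 1 (2 - ‖x‖ / n))

lemma mem_box_iff_norm_le {d n : ℕ} {x : Vert d} : x ∈ box d (n : ℝ) ↔ ‖x‖ ≤ n := by
  rw [mem_box_natCast, pi_norm_le_iff_of_nonneg (Nat.cast_nonneg n)]
  refine forall_congr' fun i => ?_
  rw [Int.norm_eq_abs, abs_le]
  exact_mod_cast Iff.rfl

lemma cutoff_nonneg {d n : ℕ} (x : Vert d) : 0 ≤ cutoff d n x := le_max_left _ _

lemma cutoff_eq_one {d n : ℕ} (hn : 1 ≤ n) {x : Vert d} (hx : x ∈ box d (n : ℝ)) :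
    cutoff d n x = 1 := by
  have h0 : (0 : ℝ) < n := by exact_mod_cast hn
  have : ‖x‖ / n ≤ 1 := (div_le_one h0).2 (mem_box_iff_norm_le.1 hx)
  rw [cutoff, min_eq_left (by linarith), max_eq_right zero_le_one]

lemma cutoff_eq_zero {d n : ℕ} (hn : 1 ≤ n) {x : Vert d}
    (hx : x ∉ box d ((2 * n : ℕ) : ℝ)) : cutoff d n x = 0 := by
  have h0 : (0 : ℝ) < n := by exact_mod_cast hn
  rw [mem_box_iff_norm_le, not_le] at hx
  push_cast at hx
  have : 2 ≤ ‖x‖ / n := (le_div_iff₀ h0).2 hx.le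
  rw [cutoff, max_eq_left ((min_le_right _ _).trans (by linarith))]

lemma norm_unitv_le {d : ℕ} (i : Fin d) : ‖unitv d i‖ ≤ 1 := by
  rw [pi_norm_le_iff_of_nonneg zero_le_one]
  intro j
  unfold unitv
  split_ifs <;> simp

lemma abs_cutoff_sub_le {d n : ℕ} (x : Vert d) (i : Fin d) :
    |cutoff d n (x + unitv d i) - cutoff d n x| ≤ 1 / n := by
  have h1 : |‖x + unitv d i‖ - ‖x‖| ≤ 1 :=
    (abs_norm_sub_norm_le _ _).trans (by simpa using norm_unitv_le i)
  refine (abs_max_sub_max_le_max _ _ _ _).trans (max_le (by simp) ?_)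
  refine (abs_min_sub_min_le_max _ _ _ _).trans (max_le (by simp) ?_)
  rw [show 2 - ‖x + unitv d i‖ / n - (2 - ‖x‖ / n) = -((‖x + unitv d i‖ - ‖x‖) / n) by ring,
    abs_neg, abs_div, Nat.abs_cast]
  gcongr

/-- Truncation at levels `-K` and `K`. -/
def clamp (K t : ℝ) : ℝ := max (-K) (min K t)

lemma abs_clamp_le {K : ℝ} (hK : 0 ≤ K) (t : ℝ) : |clamp K t| ≤ K :=
  abs_le.2 ⟨le_max_left _ _, max_le (by linarith) (min_le_left _ _)⟩

lemma clamp_mono (K : ℝ) : Monotone (clamp K) := fun _ _ h =>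
  max_le_max_left _ (min_le_min_left _ h)

lemma clamp_of_abs_le {K t : ℝ} (h : |t| ≤ K) : clamp K t = t := by
  rw [abs_le] at h
  rw [clamp, min_eq_right h.2, max_eq_right h.1]

lemma mul_clamp_sub_nonneg {A s t K : ℝ} (h : 0 ≤ A * (t - s)) :
    0 ≤ A * (clamp K t - clamp K s) := by
  rcases lt_trichotomy s t with hst | rfl | hst
  · exact mul_nonneg (nonneg_of_mul_nonneg_left h (sub_pos.2 hst))
      (sub_nonneg.2 (clamp_mono K hst.le))
  · simp
  · have hA : A ≤ 0 := by
      by_contra hA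
      push Not at hA
      nlinarith
    exact mul_nonneg_of_nonpos_of_nonpos hA (sub_nonpos.2 (clamp_mono K hst.le))

lemma min_mul_sub_le {A s t K : ℝ} (hK : 0 < K) (h : 0 ≤ A * (t - s)) :
    min (A * (t - s)) 1 - (|s| + |t|) / K ≤ A * (clamp K t - clamp K s) := by
  have h0 : 0 ≤ (|s| + |t|) / K := by positivity
  by_cases hG : |s| ≤ K ∧ |t| ≤ K
  · rw [clamp_of_abs_le hG.1, clamp_of_abs_le hG.2]
    linarith [min_le_left (A * (t - s)) 1]
  · have h1 : 1 ≤ (|s| + |t|) / K := by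
      rw [one_le_div hK]
      by_contra hlt
      push Not at hlt
      exact hG ⟨by linarith [abs_nonneg t], by linarith [abs_nonneg s]⟩
    linarith [min_le_right (A * (t - s)) 1, mul_clamp_sub_nonneg (K := K) h]

/-- Caccioppoli-type estimate for a divergence-free field tested against a truncated potential. -/
lemma sum_min_energy_le {d n : ℕ} (hn : 1 ≤ n) {ε : ℝ} (hε : 0 < ε) {χ : Vert d → ℝ}
    {A : Vert d → Fin d → ℝ} (hA : ∀ y i, 0 ≤ A y i * (χ (y + unitv d i) - χ y))
    (hdiv : ∀ y, ∑ i, (A y i - A (y - unitv d i) i) = 0) :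
    ∑ y ∈ box d (n : ℝ), ∑ i, (min (A y i * (χ (y + unitv d i) - χ y)) 1 -
        (|χ y| + |χ (y + unitv d i)|) / (ε * n)) ≤
      ε * ∑ y ∈ box d ((2 * n + 1 : ℕ) : ℝ), ∑ i, |A y i| := by
  have h0 : (0 : ℝ) < n := by exact_mod_cast hn
  have hK : 0 < ε * n := mul_pos hε h0
  set T := clamp (ε * n)
  set h : Vert d → ℝ := fun x => cutoff d n x * T (χ x) with hh
  have hsum := sum_box_mul_div (n := 2 * n) (h := h)
    (fun x hx => by rw [hh]; simp only [cutoff_eq_zero hn hx, zero_mul]) A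
  simp only [hdiv, mul_zero, Finset.sum_const_zero] at hsum
  have hterm : ∀ y i, cutoff d n y * (A y i * (T (χ (y + unitv d i)) - T (χ y))) ≤
      A y i * (h (y + unitv d i) - h y) + ε * |A y i| := by
    intro y i
    have h1 : |A y i * ((cutoff d n (y + unitv d i) - cutoff d n y) * T (χ (y + unitv d i)))| ≤
        ε * |A y i| := by
      rw [abs_mul, abs_mul, mul_comm ε]
      refine mul_le_mul_of_nonneg_left ?_ (abs_nonneg _)
      calc _ ≤ 1 / (n : ℝ) * (ε * n) :=
            mul_le_mul (abs_cutoff_sub_le y i) (abs_clamp_le hK.le _) (abs_nonneg _)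
              (by positivity)
        _ = ε := by field_simp
    have h2 := (abs_le.1 h1).1
    simp only [hh]
    linarith
  calc _ ≤ ∑ y ∈ box d (n : ℝ), ∑ i,
        cutoff d n y * (A y i * (T (χ (y + unitv d i)) - T (χ y))) := by
        refine Finset.sum_le_sum fun y hy => Finset.sum_le_sum fun i _ => ?_
        rw [cutoff_eq_one hn hy, one_mul]
        exact min_mul_sub_le hK (hA y i)
    _ ≤ ∑ y ∈ box d ((2 * n + 1 : ℕ) : ℝ), ∑ i,
        cutoff d n y * (A y i * (T (χ (y + unitv d i)) - T (χ y))) :=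
        Finset.sum_le_sum_of_subset_of_nonneg (box_subset_box (by omega)) fun y _ _ =>
          Finset.sum_nonneg fun i _ =>
            mul_nonneg (cutoff_nonneg y) (mul_clamp_sub_nonneg (hA y i))
    _ ≤ ∑ y ∈ box d ((2 * n + 1 : ℕ) : ℝ), ∑ i,
        (A y i * (h (y + unitv d i) - h y) + ε * |A y i|) :=
        Finset.sum_le_sum fun y _ => Finset.sum_le_sum fun i _ => hterm y i
    _ = _ := by
        simp only [Finset.sum_add_distrib, Finset.mul_sum]
        linarith

/-- Under an ergodic law, a centred curl-free field and a divergence-free field whose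
coordinatewise products are nonnegative have vanishing products. -/
lemma ErgodicEnv.mul_ae_eq_zero {d : ℕ} {P : Measure (EnvSp d)} [IsProbabilityMeasure P]
    (herg : ErgodicEnv d P) (hinv : ∀ x, MeasurePreserving (shift d x) P P)
    {a b : EnvSp d → Fin d → ℝ} (hai : ∀ i, Integrable (fun ω' => a ω' i) P)
    (hbi : ∀ i, Integrable (fun ω' => b ω' i) P)
    (hab : ∀ ω' i, 0 ≤ a ω' i * b ω' i) (h0 : ∀ i, ∫ ω', b ω' i ∂P = 0)
    (hloop : ∀ l : EdgeIx d →₀ ℝ, chainBd d l = 0 → ∀ᵐ ω' ∂P, chainPair d b ω' l = 0)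
    (hdiv : ∀ᵐ ω' ∂P, ∑ i, (a ω' i - a (shift d (-unitv d i) ω') i) = 0) (i : Fin d) :
    ∀ᵐ ω' ∂P, a ω' i * b ω' i = 0 := by
  obtain ⟨χ, hχi, hχ, hχb⟩ := exists_cocycle hinv hbi hloop
  set m : ℝ := ∑ i, ∫ ω', min (a ω' i * b ω' i) 1 ∂P with hm
  set M : ℝ := ∑ i, ∫ ω', |a ω' i| ∂P
  have hmi : ∀ i, Integrable (fun ω' => min (a ω' i * b ω' i) 1) P := fun i => by
    refine Integrable.of_bound (((hai i).aestronglyMeasurable.mul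
      (hbi i).aestronglyMeasurable).inf aestronglyMeasurable_const) 1 (ae_of_all _ fun ω' => ?_)
    rw [Real.norm_eq_abs, abs_of_nonneg (le_min (hab ω' i) zero_le_one)]
    exact min_le_right _ _
  have hpath : ∀ (n : ℕ) (_ : 1 ≤ n) (ε : ℝ) (_ : 0 < ε), ∀ᵐ ω' ∂P,
      ∑ y ∈ box d (n : ℝ), ∑ i, (min (a (shift d y ω') i * b (shift d y ω') i) 1 -
        (|χ y ω'| + |χ (y + unitv d i) ω'|) / (ε * n)) ≤
      ε * ∑ y ∈ box d ((2 * n + 1 : ℕ) : ℝ), ∑ i, |a (shift d y ω') i| := by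
    intro n hn ε hε
    have h1 : ∀ᵐ ω' ∂P, ∀ y, ∑ i, (a (shift d y ω') i -
        a (shift d (-unitv d i) (shift d y ω')) i) = 0 :=
      ae_all_iff.2 fun y => (hinv y).quasiMeasurePreserving.ae hdiv
    have h2 : ∀ᵐ ω' ∂P, ∀ y i, χ (unitv d i) (shift d y ω') = b (shift d y ω') i :=
      ae_all_iff.2 fun y => ae_all_iff.2 fun i =>
        (hinv y).quasiMeasurePreserving.ae (hχb i)
    have h3 : ∀ᵐ ω' ∂P, ∀ y i, χ (y + unitv d i) ω' =
        χ y ω' + χ (unitv d i) (shift d y ω') :=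
      ae_all_iff.2 fun y => ae_all_iff.2 fun i => hχ y _
    filter_upwards [h1, h2, h3] with ω' h1 h2 h3
    have hB : ∀ y i, b (shift d y ω') i = χ (y + unitv d i) ω' - χ y ω' := fun y i => by
      rw [h3, ← h2]
      ring
    simp only [hB]
    refine sum_min_energy_le hn hε (χ := fun y => χ y ω') (fun y i => ?_) fun y => ?_
    · rw [← hB]
      exact hab _ _
    · rw [← h1 y]
      simp only [shift_shift, neg_add_eq_sub]
  have hbound : ∀ (n : ℕ) (_ : 1 ≤ n) (ε : ℝ) (_ : 0 < ε) (R : ℝ)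
      (_ : ∀ x ∈ box d ((n + 1 : ℕ) : ℝ), ∫ ω', |χ x ω'| ∂P ≤ R),
      m ≤ 2 * d * R / (ε * n) + ε * 3 ^ d * M := by
    intro n hn ε hε R hR
    have h0 : (0 : ℝ) < n := by exact_mod_cast hn
    have hc := card_box_pos d n
    have i1 : ∀ y i, Integrable (fun ω' => min (a (shift d y ω') i * b (shift d y ω') i) 1) P :=
      fun y i => integrable_comp_shift hinv (hmi i) y
    have i2 : ∀ y i, Integrable
        (fun ω' => (|χ y ω'| + |χ (y + unitv d i) ω'|) / (ε * n)) P := fun y i =>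
      ((hχi _).abs.add (hχi _).abs).div_const _
    have i4 : ∀ y i, Integrable (fun ω' => min (a (shift d y ω') i * b (shift d y ω') i) 1 -
        (|χ y ω'| + |χ (y + unitv d i) ω'|) / (ε * n)) P := fun y i => (i1 y i).sub (i2 y i)
    have i3 : ∀ y i, Integrable (fun ω' => |a (shift d y ω') i|) P :=
      fun y i => integrable_comp_shift hinv (hai i).abs y
    have key := integral_mono_ae (integrable_finsetSum _ fun y _ => integrable_finsetSum _
      fun i _ => i4 y i) ((integrable_finsetSum _ fun y _ =>
      integrable_finsetSum _ fun i _ => i3 y i).const_mul ε) (hpath n hn ε hε)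
    rw [integral_const_mul, integral_finsetSum _ fun y _ => integrable_finsetSum _
      fun i _ => i3 y i, integral_finsetSum _ fun y _ => integrable_finsetSum _
      fun i _ => i4 y i] at key
    have e3 : ∀ y, ∫ ω', ∑ i, |a (shift d y ω') i| ∂P = M := fun y => by
      rw [integral_finsetSum _ fun i _ => i3 y i]
      exact Finset.sum_congr rfl fun i _ =>
        integral_comp_shift hinv (hai i).abs.aestronglyMeasurable y
    have e1 : ∀ y ∈ box d (n : ℝ), m - d * (2 * R / (ε * n)) ≤
        ∫ ω', ∑ i, (min (a (shift d y ω') i * b (shift d y ω') i) 1 -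
        (|χ y ω'| + |χ (y + unitv d i) ω'|) / (ε * n)) ∂P := by
      intro y hy
      rw [integral_finsetSum _ fun i _ => i4 y i]
      have : m - d * (2 * R / (ε * n)) =
          ∑ i, (∫ ω', min (a ω' i * b ω' i) 1 ∂P - 2 * R / (ε * n)) := by
        rw [Finset.sum_sub_distrib, hm]
        simp
      rw [this]
      refine Finset.sum_le_sum fun i _ => ?_
      rw [integral_sub (i1 y i) (i2 y i), integral_div,
        integral_add (hχi _).abs (hχi _).abs,
        integral_comp_shift hinv (hmi i).aestronglyMeasurable y]
      have := hR y (box_subset_box (by omega) hy)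
      have := hR _ (add_unitv_mem_box hy i)
      gcongr
      linarith
    have e4 := (Finset.sum_le_sum e1).trans key
    simp only [e3, Finset.sum_const, nsmul_eq_mul] at e4
    have e5 : ((box d ((2 * n + 1 : ℕ) : ℝ)).card : ℝ) ≤ 3 ^ d * (box d (n : ℝ)).card := by
      rw [card_box_natCast, card_box_natCast, ← Nat.cast_ofNat (R := ℝ), ← Nat.cast_pow,
        ← Nat.cast_mul, ← mul_pow]
      exact_mod_cast Nat.pow_le_pow_left (by omega) d
    have hM : 0 ≤ M := Finset.sum_nonneg fun i _ => integral_nonneg fun _ => abs_nonneg _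
    have e6 : ((box d (n : ℝ)).card : ℝ) * (m - d * (2 * R / (ε * n))) ≤
        (box d (n : ℝ)).card * (ε * 3 ^ d * M) := by
      calc _ ≤ _ := e4
        _ ≤ ε * (3 ^ d * (box d (n : ℝ)).card * M) := by gcongr
        _ = _ := by ring
    have e7 := le_of_mul_le_mul_left e6 hc
    rw [show 2 * d * R / (ε * n) = d * (2 * R / (ε * n)) by ring]
    linarith
  have hm0 : m ≤ 0 := by
    have h0' : ∀ i, ∫ ω', χ (unitv d i) ω' ∂P = 0 := fun i => by
      rw [integral_congr_ae (hχb i), h0]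
    have hlim : ∀ ε : ℝ, 0 < ε → m ≤ ε * (6 * d + 3 ^ d * M) := by
      intro ε hε
      obtain ⟨C, hC⟩ := cocycle_sublinear herg hinv hχi hχ h0' (pow_pos hε 2)
      obtain ⟨N, hN⟩ := exists_nat_ge (C / ε ^ 2)
      have hn : 1 ≤ max N 1 := le_max_right _ _
      set n := max N 1
      have hnr : (1 : ℝ) ≤ n := by exact_mod_cast hn
      have hC' : C ≤ ε ^ 2 * n := by
        rw [div_le_iff₀ (pow_pos hε 2)] at hN
        have : (N : ℝ) ≤ n := by exact_mod_cast le_max_left _ _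
        nlinarith [pow_pos hε 2]
      have := hbound n hn ε hε (3 * ε ^ 2 * n) fun x hx => (hC _ x hx).trans (by
        push_cast
        nlinarith [pow_pos hε 2])
      refine this.trans (le_of_eq ?_)
      field_simp
      ring
    refine le_of_forall_pos_le_add fun δ hδ => ?_
    have hM : 0 ≤ M := Finset.sum_nonneg fun i _ => integral_nonneg fun _ => abs_nonneg _
    have hpos : 0 < 6 * (d : ℝ) + 3 ^ d * M + 1 := by positivity
    refine (hlim (δ / (6 * d + 3 ^ d * M + 1)) (by positivity)).trans ?_
    rw [zero_add, div_mul_eq_mul_div, div_le_iff₀ hpos]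
    nlinarith
  have hnn : ∀ i, 0 ≤ ∫ ω', min (a ω' i * b ω' i) 1 ∂P := fun i =>
    integral_nonneg fun ω' => le_min (hab ω' i) zero_le_one
  have hi : ∫ ω', min (a ω' i * b ω' i) 1 ∂P = 0 :=
    le_antisymm ((Finset.single_le_sum (fun i _ => hnn i) (Finset.mem_univ i)).trans hm0) (hnn i)
  rw [integral_eq_zero_iff_of_nonneg (fun ω' => le_min (hab ω' i) zero_le_one) (hmi i)] at hi
  filter_upwards [hi] with ω' h
  rcases min_choice (a ω' i * b ω' i) 1 with h' | h'
  · rw [← h', h]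
    rfl
  · rw [h'] at h
    simp at h

end Rigidity

section Density

open BoundedContinuousFunction

lemma ae_eq_zero_of_forall_integral_bcf_mul {X : Type*} [TopologicalSpace X]
    [MeasurableSpace X] [BorelSpace X] [HasOuterApproxClosed X] {μ : Measure X} {g : X → ℝ}
    (hg : Integrable g μ) (h : ∀ φ : X →ᵇ ℝ, ∫ x, φ x * g x ∂μ = 0) : g =ᵐ[μ] 0 := by
  refine ae_eq_zero_of_forall_setIntegral_isClosed_eq_zero hg fun F hF => ?_
  rw [← integral_indicator hF.measurableSet]
  have hφ : ∀ n, ∫ x, ((hF.apprSeq n x : ℝ≥0) : ℝ) * g x ∂μ = 0 := fun n => by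
    let φ : X →ᵇ ℝ := .ofNormedAddCommGroup (fun x => ((hF.apprSeq n x : ℝ≥0) : ℝ))
      (NNReal.continuous_coe.comp (hF.apprSeq n).continuous) 1 fun x => by
        rw [Real.norm_eq_abs, NNReal.abs_eq]
        exact_mod_cast HasOuterApproxClosed.apprSeq_apply_le_one hF n x
    exact h φ
  have hlim := tendsto_integral_of_dominated_convergence (μ := μ)
    (F := fun n x => ((hF.apprSeq n x : ℝ≥0) : ℝ) * g x) (f := F.indicator g) (fun x => ‖g x‖)
    (fun n => (NNReal.continuous_coe.comp
      (hF.apprSeq n).continuous).aestronglyMeasurable.mul hg.aestronglyMeasurable) hg.norm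
    (fun n => ae_of_all _ fun x => by
      rw [norm_mul, Real.norm_eq_abs, NNReal.abs_eq]
      refine mul_le_of_le_one_left (norm_nonneg _) ?_
      exact_mod_cast HasOuterApproxClosed.apprSeq_apply_le_one hF n x)
    (ae_of_all _ fun x => by
      have h1 := tendsto_pi_nhds.1 (HasOuterApproxClosed.tendsto_apprSeq hF) x
      have h2 := (NNReal.tendsto_coe.2 h1).mul_const (g x)
      convert h2 using 2
      by_cases hx : x ∈ F <;> simp [hx])
  simp only [hφ] at hlim
  exact tendsto_nhds_unique hlim tendsto_const_nhds

/-- The translate of a bounded continuous function on `Ω`. -/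
def bcfShift {d : ℕ} (x : Vert d) (h : EnvSp d →ᵇ ℝ) : EnvSp d →ᵇ ℝ :=
  h.compContinuous ⟨shift d x, continuous_shift d x⟩

@[simp] lemma bcfShift_apply {d : ℕ} (x : Vert d) (h : EnvSp d →ᵇ ℝ) (ω : EnvSp d) :
    bcfShift x h ω = h (shift d x ω) := rfl

lemma _root_.MeasureTheory.Integrable.bcf_mul {X : Type*} [TopologicalSpace X] [MeasurableSpace X]
    [OpensMeasurableSpace X] {μ : Measure X} {f : X → ℝ} (hf : Integrable f μ) (φ : X →ᵇ ℝ) :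
    Integrable (fun x => φ x * f x) μ :=
  hf.bdd_mul φ.continuous.aestronglyMeasurable (ae_of_all _ φ.norm_coe_le_norm)

/-- Integration by parts on `Ω`. -/
lemma integral_bcf_mul_div {d : ℕ} {P : Measure (EnvSp d)}
    (hinv : ∀ x, MeasurePreserving (shift d x) P P) {A : EnvSp d → Fin d → ℝ}
    (hA : ∀ i, Integrable (fun ω' => A ω' i) P) (h : EnvSp d →ᵇ ℝ) :
    ∫ ω', h ω' * ∑ i, (A ω' i - A (shift d (-unitv d i) ω') i) ∂P =
      -∑ i, ∫ ω', A ω' i * (h (shift d (unitv d i) ω') - h ω') ∂P := by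
  have hs : ∀ i, Integrable (fun ω' => A (shift d (-unitv d i) ω') i) P := fun i =>
    integrable_comp_shift hinv (hA i) _
  have h1 : ∀ i, Integrable (fun ω' => h ω' * A ω' i) P := fun i => (hA i).bcf_mul h
  have h2 : ∀ i, Integrable (fun ω' => h ω' * A (shift d (-unitv d i) ω') i) P := fun i =>
    (hs i).bcf_mul h
  have h3 : ∀ i, Integrable (fun ω' => h (shift d (unitv d i) ω') * A ω' i) P := fun i =>
    (hA i).bcf_mul (bcfShift (unitv d i) h)
  have h4 : ∀ i, ∫ ω', h ω' * A (shift d (-unitv d i) ω') i ∂P =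
      ∫ ω', h (shift d (unitv d i) ω') * A ω' i ∂P := fun i => by
    rw [← integral_comp_shift hinv (h3 i).aestronglyMeasurable (-unitv d i)]
    simp only [shift_shift, add_neg_cancel, shift_zero]
  have h5 : ∀ i, Integrable
      (fun ω' => h ω' * A ω' i - h ω' * A (shift d (-unitv d i) ω') i) P :=
    fun i => (h1 i).sub (h2 i)
  have h6 : ∀ i, ∫ ω', A ω' i * (h (shift d (unitv d i) ω') - h ω') ∂P =
      ∫ ω', (h (shift d (unitv d i) ω') * A ω' i - h ω' * A ω' i) ∂P := fun i =>
    integral_congr_ae (ae_of_all _ fun ω' => by ring)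
  simp only [Finset.mul_sum, h6]
  simp only [mul_sub]
  rw [integral_finsetSum _ fun i _ => h5 i, ← Finset.sum_neg_distrib]
  refine Finset.sum_congr rfl fun i _ => ?_
  rw [integral_sub (h1 i) (h2 i), h4, integral_sub (h3 i) (h1 i), neg_sub]

/-- Bounded continuous divergence-free vector fields on `Ω`. -/
def divFree (d : ℕ) : Submodule ℝ (Fin d → (EnvSp d →ᵇ ℝ)) where
  carrier := {j | ∀ ω, ∑ i, (j i ω - j i (shift d (-unitv d i) ω)) = 0}
  zero_mem' := fun ω => by simp
  add_mem' := fun {j k} hj hk ω => by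
    have h := congrArg₂ (· + ·) (hj ω) (hk ω)
    simp only [add_zero, ← Finset.sum_add_distrib] at h
    refine Eq.trans ?_ h
    refine Finset.sum_congr rfl fun i _ => ?_
    simp only [Pi.add_apply, BoundedContinuousFunction.add_apply]
    ring
  smul_mem' := fun t j hj ω => by
    have h := congrArg (t * ·) (hj ω)
    simp only [mul_zero, Finset.mul_sum] at h
    refine Eq.trans ?_ h
    refine Finset.sum_congr rfl fun i _ => ?_
    simp only [Pi.smul_apply, BoundedContinuousFunction.coe_smul, smul_eq_mul]
    ring

lemma mem_divFree {d : ℕ} {j : Fin d → (EnvSp d →ᵇ ℝ)} :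
    j ∈ divFree d ↔ ∀ ω, ∑ i, (j i ω - j i (shift d (-unitv d i) ω)) = 0 := Iff.rfl

/-- The divergence-free field associated with a cycle `l` and a weight `g`. -/
def cycleField {d : ℕ} (l : EdgeIx d →₀ ℝ) (g : EnvSp d →ᵇ ℝ) (i : Fin d) : EnvSp d →ᵇ ℝ :=
  ∑ e ∈ l.support, if e.2 = i then l e • bcfShift (-e.1) g else 0

lemma cycleField_apply {d : ℕ} (l : EdgeIx d →₀ ℝ) (g : EnvSp d →ᵇ ℝ) (i : Fin d)
    (ω : EnvSp d) :
    cycleField l g i ω = ∑ e ∈ l.support, if e.2 = i then l e * g (shift d (-e.1) ω) else 0 := by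
  rw [cycleField, BoundedContinuousFunction.sum_apply]
  refine Finset.sum_congr rfl fun e _ => ?_
  split_ifs <;> simp

lemma cycleField_mem_divFree {d : ℕ} {l : EdgeIx d →₀ ℝ} (hl : chainBd d l = 0)
    (g : EnvSp d →ᵇ ℝ) : cycleField l g ∈ divFree d := by
  intro ω
  have h := congrArg (Finsupp.linearCombination ℝ fun x => g (shift d (-x) ω)) hl
  rw [chainBd, Finsupp.linearCombination_apply ℝ l, Finsupp.sum, map_sum, map_zero] at h
  refine Eq.trans ?_ h
  simp only [cycleField_apply, ← Finset.sum_sub_distrib]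
  rw [Finset.sum_comm]
  refine Finset.sum_congr rfl fun e _ => ?_
  rw [Finset.sum_eq_single e.2 (fun i _ hi => by simp [hi.symm]) (by simp)]
  simp only [if_true, map_smul, map_sub, Finsupp.linearCombination_single, one_mul,
    smul_eq_mul, shift_shift, neg_add, mul_sub]

section

variable {d : ℕ} {P : Measure (EnvSp d)}

lemma memLp_sqrt_coord {e : EdgeIx d} (hc : Integrable (fun ω' : EnvSp d => ω'.1 e) P) :
    MemLp (fun ω' : EnvSp d => √(ω'.1 e)) 2 P := by
  rw [memLp_two_iff_integrable_sq (continuous_coord d e).sqrt.aestronglyMeasurable]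
  exact hc.congr (ae_of_all _ fun ω' => (Real.sq_sqrt (ω'.2 e).le).symm)

lemma memLp_inv_sqrt_coord {e : EdgeIx d}
    (hc : Integrable (fun ω' : EnvSp d => (ω'.1 e)⁻¹) P) :
    MemLp (fun ω' : EnvSp d => (√(ω'.1 e))⁻¹) 2 P := by
  have hm : Continuous fun ω' : EnvSp d => (√(ω'.1 e))⁻¹ :=
    (continuous_coord d e).sqrt.inv₀ fun ω' => (Real.sqrt_pos.2 (ω'.2 e)).ne'
  rw [memLp_two_iff_integrable_sq hm.aestronglyMeasurable]
  exact hc.congr (ae_of_all _ fun ω' => by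
    simp only [inv_pow, Real.sq_sqrt (ω'.2 e).le])

/-- The sum of a gradient and a divergence-free field, in the coordinates in which the
conductance-weighted norm becomes the plain `L²` norm. -/
def helmholtz (h : EnvSp d →ᵇ ℝ) (j : Fin d → (EnvSp d →ᵇ ℝ)) (i : Fin d) (ω : EnvSp d) : ℝ :=
  √(ω.1 (0, i)) * (h (shift d (unitv d i) ω) - h ω) + (√(ω.1 (0, i)))⁻¹ * j i ω

lemma memLp_mul_bcf {f : EnvSp d → ℝ} (hf : MemLp f 2 P) (h : EnvSp d →ᵇ ℝ) :
    MemLp (fun ω' => f ω' * h ω') 2 P := by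
  have : MemLp h ∞ P := memLp_top_of_bound h.continuous.aestronglyMeasurable ‖h‖
    (ae_of_all _ h.norm_coe_le_norm)
  exact this.mul hf

lemma memLp_helmholtz (hc : ∀ i, Integrable (fun ω' : EnvSp d => ω'.1 (0, i)) P)
    (hc' : ∀ i, Integrable (fun ω' : EnvSp d => (ω'.1 (0, i))⁻¹) P)
    (h : EnvSp d →ᵇ ℝ) (j : Fin d → (EnvSp d →ᵇ ℝ)) (i : Fin d) :
    MemLp (helmholtz h j i) 2 P :=
  (memLp_mul_bcf (memLp_sqrt_coord (hc i)) (bcfShift (unitv d i) h - h)).add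
    (memLp_mul_bcf (memLp_inv_sqrt_coord (hc' i)) (j i))

/-- The subspace of sums of gradients and divergence-free fields. -/
def helmholtzSubmodule (d : ℕ) (P : Measure (EnvSp d)) :
    Submodule ℝ (PiLp 2 fun _ : Fin d => Lp ℝ 2 P) where
  carrier := {y | ∃ h, ∃ j ∈ divFree d, ∀ i, y i =ᵐ[P] helmholtz h j i}
  zero_mem' := ⟨0, 0, zero_mem _, fun i => by
    filter_upwards [Lp.coeFn_zero ℝ 2 P] with ω' h
    rw [PiLp.zero_apply, h]
    simp [helmholtz]⟩
  add_mem' := by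
    rintro y z ⟨h, j, hj, hy⟩ ⟨h', j', hj', hz⟩
    refine ⟨h + h', j + j', add_mem hj hj', fun i => ?_⟩
    filter_upwards [Lp.coeFn_add (y i) (z i), hy i, hz i] with ω' h1 h2 h3
    rw [PiLp.add_apply, h1, Pi.add_apply, h2, h3]
    simp only [helmholtz, Pi.add_apply, BoundedContinuousFunction.add_apply]
    ring
  smul_mem' := by
    rintro t y ⟨h, j, hj, hy⟩
    refine ⟨t • h, t • j, Submodule.smul_mem _ t hj, fun i => ?_⟩
    filter_upwards [Lp.coeFn_smul t (y i), hy i] with ω' h1 h2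
    rw [PiLp.smul_apply, h1, Pi.smul_apply, h2]
    simp only [helmholtz, Pi.smul_apply, BoundedContinuousFunction.coe_smul, smul_eq_mul]
    ring

lemma sum_integral_helmholtz_mul_eq_zero
    (hc : ∀ i, Integrable (fun ω' : EnvSp d => ω'.1 (0, i)) P)
    (hc' : ∀ i, Integrable (fun ω' : EnvSp d => (ω'.1 (0, i))⁻¹) P)
    {y : PiLp 2 fun _ : Fin d => Lp ℝ 2 P} (hy : y ∈ (helmholtzSubmodule d P)ᗮ)
    (h : EnvSp d →ᵇ ℝ) {j : Fin d → (EnvSp d →ᵇ ℝ)} (hj : j ∈ divFree d) :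
    ∑ i, ∫ ω', helmholtz h j i ω' * y i ω' ∂P = 0 := by
  let w : PiLp 2 fun _ : Fin d => Lp ℝ 2 P :=
    WithLp.toLp 2 fun i => (memLp_helmholtz hc hc' h j i).toLp
  have hw : ∀ i, w i =ᵐ[P] helmholtz h j i := fun i =>
    (memLp_helmholtz hc hc' h j i).coeFn_toLp
  have := (Submodule.mem_orthogonal _ _).1 hy w ⟨h, j, hj, hw⟩
  rw [PiLp.inner_apply] at this
  refine Eq.trans (Finset.sum_congr rfl fun i _ => ?_) this
  rw [L2.inner_def]
  refine integral_congr_ae ?_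
  filter_upwards [hw i] with ω' h1
  rw [← h1]
  simp [mul_comm]

lemma helmholtzSubmodule_orthogonal [IsProbabilityMeasure P] (herg : ErgodicEnv d P)
    (hinv : ∀ x, MeasurePreserving (shift d x) P P)
    (hc : ∀ i, Integrable (fun ω' : EnvSp d => ω'.1 (0, i)) P)
    (hc' : ∀ i, Integrable (fun ω' : EnvSp d => (ω'.1 (0, i))⁻¹) P) :
    (helmholtzSubmodule d P)ᗮ = ⊥ := by
  refine (Submodule.eq_bot_iff _).2 fun y hy => ?_
  set a : EnvSp d → Fin d → ℝ := fun ω' i => √(ω'.1 (0, i)) * y i ω' with ha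
  set b : EnvSp d → Fin d → ℝ := fun ω' i => (√(ω'.1 (0, i)))⁻¹ * y i ω' with hb
  have hsq : ∀ (ω' : EnvSp d) i, 0 < √(ω'.1 (0, i)) := fun ω' i => Real.sqrt_pos.2 (ω'.2 _)
  have hai : ∀ i, Integrable (fun ω' => a ω' i) P := fun i =>
    (memLp_sqrt_coord (hc i)).integrable_mul (Lp.memLp (y i))
  have hbi : ∀ i, Integrable (fun ω' => b ω' i) P := fun i =>
    (memLp_inv_sqrt_coord (hc' i)).integrable_mul (Lp.memLp (y i))
  have hab : ∀ ω' i, a ω' i * b ω' i = y i ω' ^ 2 := fun ω' i => by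
    have := (hsq ω' i).ne'
    simp only [ha, hb]
    field_simp
  have horth : ∀ j ∈ divFree d, ∑ i, ∫ ω', j i ω' * b ω' i ∂P = 0 := fun j hj => by
    refine Eq.trans ?_ (sum_integral_helmholtz_mul_eq_zero hc hc' hy 0 hj)
    refine Finset.sum_congr rfl fun i _ => integral_congr_ae (ae_of_all _ fun ω' => ?_)
    simp only [helmholtz, hb, BoundedContinuousFunction.coe_zero, Pi.zero_apply]
    ring
  have hdiv : ∀ᵐ ω' ∂P, ∑ i, (a ω' i - a (shift d (-unitv d i) ω') i) = 0 := by
    refine ae_eq_zero_of_forall_integral_bcf_mul (integrable_finsetSum _ fun i _ =>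
      (hai i).sub (integrable_comp_shift hinv (hai i) _)) fun φ => ?_
    rw [integral_bcf_mul_div hinv hai, neg_eq_zero]
    refine Eq.trans (Finset.sum_congr rfl fun i _ => ?_)
      (sum_integral_helmholtz_mul_eq_zero hc hc' hy φ (zero_mem (divFree d)))
    refine integral_congr_ae (ae_of_all _ fun ω' => ?_)
    simp only [helmholtz, ha, Pi.zero_apply, BoundedContinuousFunction.coe_zero]
    ring
  have h0 : ∀ i, ∫ ω', b ω' i ∂P = 0 := fun i => by
    have := horth (Pi.single i (BoundedContinuousFunction.const _ 1)) fun ω' => by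
      refine Finset.sum_eq_zero fun k _ => ?_
      rcases eq_or_ne k i with rfl | hk
      · simp
      · simp [Pi.single_eq_of_ne hk]
    rw [Finset.sum_eq_single i (fun k _ hk => by simp [Pi.single_eq_of_ne hk])
      (by simp)] at this
    simpa using this
  have hloop : ∀ l : EdgeIx d →₀ ℝ, chainBd d l = 0 → ∀ᵐ ω' ∂P, chainPair d b ω' l = 0 := by
    intro l hl
    have hi : ∀ e : EdgeIx d, Integrable (fun ω' => b (shift d e.1 ω') e.2) P := fun e =>
      integrable_comp_shift hinv (hbi e.2) e.1
    simp only [chainPair_eq_sum]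
    refine ae_eq_zero_of_forall_integral_bcf_mul
      (integrable_finsetSum _ fun e _ => (hi e).const_mul _) fun g => ?_
    refine Eq.trans ?_ (horth _ (cycleField_mem_divFree hl g))
    simp only [cycleField_apply, Finset.sum_mul, Finset.mul_sum, ite_mul, zero_mul]
    have h2 : ∀ e : EdgeIx d, Integrable (fun ω' => l e * g (shift d (-e.1) ω') * b ω' e.2) P :=
      fun e => (hbi e.2).bcf_mul (l e • bcfShift (-e.1) g)
    have h3 : ∀ i, ∀ e : EdgeIx d, Integrable (fun ω' => if e.2 = i then
        l e * g (shift d (-e.1) ω') * b ω' i else 0) P := fun i e => by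
      split_ifs with h
      · exact h ▸ h2 e
      · exact integrable_zero _ _ _
    rw [integral_finsetSum _ fun e _ => ((hi e).const_mul _).bcf_mul g,
      Finset.sum_congr rfl fun i _ => integral_finsetSum _ fun e _ => h3 i e, Finset.sum_comm]
    refine Finset.sum_congr rfl fun e _ => ?_
    rw [Finset.sum_eq_single e.2 (fun i _ hi => by simp [hi.symm]) (by simp)]
    simp only [if_true]
    rw [← integral_comp_shift hinv (h2 e).aestronglyMeasurable e.1]
    simp only [shift_shift, neg_add_cancel, shift_zero]
    refine integral_congr_ae (ae_of_all _ fun ω' => ?_)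
    ring
  have hfin := herg.mul_ae_eq_zero hinv hai hbi (fun ω' i => by
    rw [hab]
    exact sq_nonneg _) h0 hloop hdiv
  ext1 i
  rw [PiLp.zero_apply]
  refine (Lp.eq_zero_iff_ae_eq_zero).2 ?_
  filter_upwards [hfin i] with ω' h
  rw [hab] at h
  exact pow_eq_zero_iff two_ne_zero |>.1 h

/-- Approximate duality between gradients and divergence-free fields: the primal and the dual
energy of a bounded continuous vector field differ by an arbitrarily small amount. -/
lemma exists_duality_gap_le [IsProbabilityMeasure P] (herg : ErgodicEnv d P)
    (hinv : ∀ x, MeasurePreserving (shift d x) P P)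
    (hc : ∀ i, Integrable (fun ω' : EnvSp d => ω'.1 (0, i)) P)
    (hc' : ∀ i, Integrable (fun ω' : EnvSp d => (ω'.1 (0, i))⁻¹) P)
    (u : Fin d → (EnvSp d →ᵇ ℝ)) {ε : ℝ} (hε : 0 < ε) :
    ∃ h : EnvSp d →ᵇ ℝ, ∃ j ∈ divFree d,
      ∑ i, ∫ ω', (ω'.1 (0, i) * u i ω' - j i ω') ^ 2 / ω'.1 (0, i) ∂P ≤
      ∑ i, ∫ ω', ω'.1 (0, i) * (-2 * u i ω' * (h (shift d (unitv d i) ω') - h ω') -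
        (h (shift d (unitv d i) ω') - h ω') ^ 2) ∂P + ε := by
  have hV : ∀ i, MemLp (fun ω' => √(ω'.1 (0, i)) * u i ω') 2 P := fun i =>
    memLp_mul_bcf (memLp_sqrt_coord (hc i)) (u i)
  let V : PiLp 2 fun _ : Fin d => Lp ℝ 2 P := WithLp.toLp 2 fun i => (hV i).toLp
  have hcl : V ∈ (helmholtzSubmodule d P).topologicalClosure := by
    rw [(Submodule.topologicalClosure_eq_top_iff).2
      (helmholtzSubmodule_orthogonal herg hinv hc hc')]
    trivial
  obtain ⟨w, ⟨h, j, hj, hw⟩, hVw⟩ := Metric.mem_closure_iff.1 hcl (√ε) (Real.sqrt_pos.2 hε)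
  refine ⟨-h, j, hj, ?_⟩
  have hnorm : ∑ i, ∫ ω', (√(ω'.1 (0, i)) * u i ω' - helmholtz h j i ω') ^ 2 ∂P ≤ ε := by
    rw [dist_eq_norm, Real.lt_sqrt (norm_nonneg _), ← real_inner_self_eq_norm_sq,
      PiLp.inner_apply] at hVw
    refine (le_of_eq (Finset.sum_congr rfl fun i _ => ?_)).trans hVw.le
    rw [L2.inner_def]
    refine integral_congr_ae ?_
    filter_upwards [Lp.coeFn_sub (V i) (w i), (hV i).coeFn_toLp, hw i] with ω' h1 h2 h3
    rw [PiLp.sub_apply, h1, Pi.sub_apply, h3, show V i = (hV i).toLp from rfl, h2]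
    simp [sq]
  have hgj : ∑ i, ∫ ω', (h (shift d (unitv d i) ω') - h ω') * j i ω' ∂P = 0 := by
    have := integral_bcf_mul_div hinv (fun i => (j i).integrable P) h
    simp only [mem_divFree.1 hj, mul_zero, integral_zero] at this
    simp only [mul_comm _ (j _ _)]
    linarith
  have hpt : ∀ i (ω' : EnvSp d), (ω'.1 (0, i) * u i ω' - j i ω') ^ 2 / ω'.1 (0, i) =
      ω'.1 (0, i) * (-2 * u i ω' * ((-h) (shift d (unitv d i) ω') - (-h) ω') -
        ((-h) (shift d (unitv d i) ω') - (-h) ω') ^ 2) +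
      (√(ω'.1 (0, i)) * u i ω' - helmholtz h j i ω') ^ 2 -
      2 * ((h (shift d (unitv d i) ω') - h ω') * j i ω') := by
    intro i ω'
    have h0 := Real.sqrt_pos.2 (ω'.2 (0, i))
    have h1 := Real.sq_sqrt (ω'.2 (0, i)).le
    simp only [helmholtz, BoundedContinuousFunction.coe_neg, Pi.neg_apply]
    set s := √(ω'.1 (0, i))
    rw [← h1]
    field_simp
    ring
  have i1 : ∀ i, Integrable (fun ω' : EnvSp d => ω'.1 (0, i) *
      (-2 * u i ω' * ((-h) (shift d (unitv d i) ω') - (-h) ω') -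
        ((-h) (shift d (unitv d i) ω') - (-h) ω') ^ 2)) P := fun i => by
    let g := bcfShift (unitv d i) (-h) - (-h)
    let φ : EnvSp d →ᵇ ℝ := (-2 : ℝ) • (u i * g) - g * g
    refine ((hc i).bcf_mul φ).congr (ae_of_all _ fun ω' => ?_)
    simp only [φ, g, BoundedContinuousFunction.sub_apply, BoundedContinuousFunction.coe_smul,
      BoundedContinuousFunction.mul_apply, bcfShift_apply, smul_eq_mul]
    ring
  have i2 : ∀ i, Integrable
      (fun ω' : EnvSp d => (√(ω'.1 (0, i)) * u i ω' - helmholtz h j i ω') ^ 2) P := fun i =>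
    ((hV i).sub (memLp_helmholtz hc hc' h j i)).integrable_sq
  have i3 : ∀ i, Integrable
      (fun ω' : EnvSp d => (h (shift d (unitv d i) ω') - h ω') * j i ω') P := fun i =>
    ((bcfShift (unitv d i) h - h) * j i).integrable P
  have hsum : ∀ i, ∫ ω', (ω'.1 (0, i) * u i ω' - j i ω') ^ 2 / ω'.1 (0, i) ∂P =
      ∫ ω', ω'.1 (0, i) * (-2 * u i ω' * ((-h) (shift d (unitv d i) ω') - (-h) ω') -
        ((-h) (shift d (unitv d i) ω') - (-h) ω') ^ 2) ∂P +
      ∫ ω', (√(ω'.1 (0, i)) * u i ω' - helmholtz h j i ω') ^ 2 ∂P -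
      2 * ∫ ω', (h (shift d (unitv d i) ω') - h ω') * j i ω' ∂P := fun i => by
    rw [integral_congr_ae (ae_of_all _ (hpt i)), ← integral_const_mul, ← integral_add (i1 i) (i2 i)]
    exact integral_sub ((i1 i).add (i2 i)) ((i3 i).const_mul 2)
  simp only [hsum, Finset.sum_sub_distrib, Finset.sum_add_distrib, ← Finset.mul_sum, hgj]
  linarith

end

end Density

section Identities

variable {d : ℕ}

lemma unitv_injective (d : ℕ) : Function.Injective (unitv d) := fun i j h => by
  have := congrFun h i
  simpa [unitv] using this

lemma cnd_add_unitv (ω : EnvSp d) (x : Vert d) (i : Fin d) :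
    cnd d ω x (x + unitv d i) = ω.1 (x, i) := by
  have h : ∀ k, ¬ x = x + unitv d i + unitv d k := fun k hk => by
    have h1 := congrFun hk i
    simp only [Pi.add_apply, unitv, if_true] at h1
    split_ifs at h1 <;> omega
  simp [cnd, h, (unitv_injective d).eq_iff]

lemma sum_nbrs_cnd_mul (ω : EnvSp d) (x : Vert d) (g : Vert d → ℝ) :
    ∑ z ∈ nbrs d x, cnd d ω x z * g z =
      ∑ i, (ω.1 (x, i) * g (x + unitv d i) + ω.1 (x - unitv d i, i) * g (x - unitv d i)) := by
  have h : ∀ (z : Vert d) i, (x = z + unitv d i) = (z = x - unitv d i) := fun z i =>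
    propext ⟨fun h => by rw [h, add_sub_cancel_right], fun h => by rw [h, sub_add_cancel]⟩
  simp only [cnd, Finset.sum_mul, h]
  rw [Finset.sum_comm]
  refine Finset.sum_congr rfl fun i _ => ?_
  simp only [add_mul, ite_mul, zero_mul, Finset.sum_add_distrib, Finset.sum_ite_eq']
  rw [if_pos, if_pos] <;> simp [nbrs]

lemma piOf_shift (ω : EnvSp d) (x : Vert d) : piOf d (shift d x ω) 0 = piOf d ω x := by
  simp [piOf, shift_apply, sub_eq_add_neg, add_comm]

lemma piOf_pos (hd : 1 ≤ d) (ω : EnvSp d) (x : Vert d) : 0 < piOf d ω x := by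
  have : Nonempty (Fin d) := ⟨⟨0, hd⟩⟩
  exact Finset.sum_pos (fun _ _ => add_pos (ω.2 _) (ω.2 _)) Finset.univ_nonempty

lemma fDiv_mul_piOf (hd : 1 ≤ d) (v : EnvSp d → Fin d → ℝ) (ω : EnvSp d) :
    fDiv d v ω * piOf d ω 0 = ∑ i, (ω.1 (0, i) * v ω i -
      (shift d (-unitv d i) ω).1 (0, i) * v (shift d (-unitv d i) ω) i) := by
  rw [fDiv, mul_comm, mul_inv_cancel_left₀ (piOf_pos hd ω 0).ne']
  refine Finset.sum_congr rfl fun i _ => ?_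
  have h1 := cnd_add_unitv ω 0 i
  have h2 := cnd_add_unitv ω (-unitv d i) i
  rw [zero_add] at h1
  rw [neg_add_cancel] at h2
  rw [h1, h2, shift_apply, zero_add]

lemma sum_nbrs_cnd_grad (ω : EnvSp d) (x : Vert d) (g : Vert d → ℝ) :
    ∑ z ∈ nbrs d x, cnd d ω x z * (g x - g z) =
      -∑ i, (ω.1 (x, i) * (g (x + unitv d i) - g x) -
        ω.1 (x - unitv d i, i) * (g (x - unitv d i + unitv d i) - g (x - unitv d i))) := by
  rw [sum_nbrs_cnd_mul ω x fun z => g x - g z, ← Finset.sum_neg_distrib]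
  refine Finset.sum_congr rfl fun i _ => ?_
  rw [sub_add_cancel]
  ring

/-- The variational functional on a box in terms of gradients. -/
lemma two_mul_innerF_sub_quadF (hd : 1 ≤ d) (v : EnvSp d → Fin d → ℝ) (ω : EnvSp d) {n : ℕ}
    {h : Vert d → ℝ} (hh : ∀ x ∉ box d (n : ℝ), h x = 0) :
    2 * innerF d ω (box d (n : ℝ)) h (fun x => fDiv d v (shift d x ω)) -
        quadF d ω (box d (n : ℝ)) h =
      ∑ y ∈ box d ((n + 1 : ℕ) : ℝ), ∑ i, ω.1 (y, i) *
        (-2 * v (shift d y ω) i * (h (y + unitv d i) - h y) - (h (y + unitv d i) - h y) ^ 2) := by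
  have h1 : innerF d ω (box d (n : ℝ)) h (fun x => fDiv d v (shift d x ω)) =
      -∑ y ∈ box d ((n + 1 : ℕ) : ℝ), ∑ i, ω.1 (y, i) * v (shift d y ω) i *
        (h (y + unitv d i) - h y) := by
    rw [← sum_box_mul_div hh fun y i => ω.1 (y, i) * v (shift d y ω) i]
    refine Finset.sum_congr rfl fun x _ => ?_
    rw [mul_assoc, ← piOf_shift, fDiv_mul_piOf hd]
    simp only [shift_shift, shift_apply, zero_add, add_zero, sub_eq_add_neg, add_comm _ x]
  have h2 : quadF d ω (box d (n : ℝ)) h =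
      ∑ y ∈ box d ((n + 1 : ℕ) : ℝ), ∑ i, ω.1 (y, i) * (h (y + unitv d i) - h y) *
        (h (y + unitv d i) - h y) := by
    rw [← neg_inj, ← sum_box_mul_div hh fun y i => ω.1 (y, i) * (h (y + unitv d i) - h y),
      quadF, ← Finset.sum_neg_distrib]
    refine Finset.sum_congr rfl fun x _ => ?_
    rw [sum_nbrs_cnd_grad, mul_comm, ← mul_neg, neg_neg]
  rw [h1, h2, mul_neg, Finset.mul_sum, ← Finset.sum_neg_distrib, ← Finset.sum_sub_distrib]
  refine Finset.sum_congr rfl fun y _ => ?_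
  rw [Finset.mul_sum, ← Finset.sum_neg_distrib, ← Finset.sum_sub_distrib]
  refine Finset.sum_congr rfl fun i _ => ?_
  ring

open BoundedContinuousFunction

/-- The integrand of the variational functional of the environment generator. -/
def primalDensity (u : Fin d → (EnvSp d →ᵇ ℝ)) (h : EnvSp d →ᵇ ℝ) (i : Fin d) (ω : EnvSp d) : ℝ :=
  ω.1 (0, i) * (-2 * u i ω * (h (shift d (unitv d i) ω) - h ω) -
    (h (shift d (unitv d i) ω) - h ω) ^ 2)

/-- The integrand of the dual variational functional. -/
def dualDensity (u j : Fin d → (EnvSp d →ᵇ ℝ)) (i : Fin d) (ω : EnvSp d) : ℝ :=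
  (ω.1 (0, i) * u i ω - j i ω) ^ 2 / ω.1 (0, i)

lemma integrable_piOf {P : Measure (EnvSp d)} (hinv : ∀ x, MeasurePreserving (shift d x) P P)
    (hc : ∀ i, Integrable (fun ω' : EnvSp d => ω'.1 (0, i)) P) :
    Integrable (fun ω' => piOf d ω' 0) P := by
  refine integrable_finsetSum _ fun i _ => (hc i).add ?_
  refine (integrable_comp_shift hinv (hc i) (-unitv d i)).congr (ae_of_all _ fun ω' => ?_)
  simp [shift_apply]

lemma integral_piOf_pos (hd : 1 ≤ d) {P : Measure (EnvSp d)} [IsProbabilityMeasure P]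
    (hi : Integrable (fun ω' => piOf d ω' 0) P) : 0 < ∫ ω', piOf d ω' 0 ∂P := by
  rw [integral_pos_iff_support_of_nonneg (fun ω' => (piOf_pos hd ω' 0).le) hi]
  have : Function.support (fun ω' => piOf d ω' 0) = Set.univ :=
    Set.eq_univ_of_forall fun ω' => (piOf_pos hd ω' 0).ne'
  simp [this]

lemma continuous_piOf (x : Vert d) : Continuous fun ω : EnvSp d => piOf d ω x :=
  continuous_finsetSum _ fun _ _ => (continuous_coord d _).add (continuous_coord d _)

lemma integral_Qmeas (hd : 1 ≤ d) {P : Measure (EnvSp d)} (g : EnvSp d → ℝ) :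
    ∫ ω', g ω' ∂(Qmeas d P) = (∫ ω', piOf d ω' 0 ∂P)⁻¹ * ∫ ω', g ω' * piOf d ω' 0 ∂P := by
  rw [Qmeas, integral_withDensity_eq_integral_toReal_smul
    ((continuous_piOf 0).measurable.div_const _).ennreal_ofReal
    (ae_of_all _ fun _ => ENNReal.ofReal_lt_top), ← integral_const_mul]
  refine integral_congr_ae (ae_of_all _ fun ω' => ?_)
  have h0 : 0 ≤ ∫ ω', piOf d ω' 0 ∂P := integral_nonneg fun ω' => (piOf_pos hd ω' 0).le
  simp only
  rw [ENNReal.toReal_ofReal (div_nonneg (piOf_pos hd ω' 0).le h0), smul_eq_mul]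
  ring

/-- The variational functional of the environment generator in terms of gradients. -/
lemma two_mul_innerQ_sub_quadQ (hd : 1 ≤ d) {P : Measure (EnvSp d)}
    (hinv : ∀ x, MeasurePreserving (shift d x) P P)
    (hc : ∀ i, Integrable (fun ω' : EnvSp d => ω'.1 (0, i)) P) (u : Fin d → (EnvSp d →ᵇ ℝ))
    (h : EnvSp d →ᵇ ℝ) :
    2 * innerQ d (Qmeas d P) h (fDiv d fun ω i => u i ω) - quadQ d (Qmeas d P) h =
      (∫ ω', piOf d ω' 0 ∂P)⁻¹ * ∑ i, ∫ ω', primalDensity u h i ω' ∂P := by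
  have hb : ∀ g : EnvSp d →ᵇ ℝ, ∀ i, Integrable (fun ω' : EnvSp d => ω'.1 (0, i) * g ω') P :=
    fun g i => ((hc i).bcf_mul g).congr (ae_of_all _ fun ω' => mul_comm _ _)
  have h1 : innerQ d (Qmeas d P) h (fDiv d fun ω i => u i ω) = (∫ ω', piOf d ω' 0 ∂P)⁻¹ *
      -∑ i, ∫ ω', ω'.1 (0, i) * u i ω' * (h (shift d (unitv d i) ω') - h ω') ∂P := by
    rw [innerQ, integral_Qmeas hd,
      ← integral_bcf_mul_div hinv (A := fun ω' i => ω'.1 (0, i) * u i ω') (fun i => hb _ i)]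
    congr 1
    refine integral_congr_ae (ae_of_all _ fun ω' => ?_)
    simp only
    rw [mul_assoc, fDiv_mul_piOf hd]
  have h2 : quadQ d (Qmeas d P) h = (∫ ω', piOf d ω' 0 ∂P)⁻¹ *
      ∑ i, ∫ ω', ω'.1 (0, i) * (h (shift d (unitv d i) ω') - h ω') *
        (h (shift d (unitv d i) ω') - h ω') ∂P := by
    rw [quadQ, integral_Qmeas hd, ← neg_neg (∑ i, _),
      ← integral_bcf_mul_div hinv
        (A := fun ω' i => ω'.1 (0, i) * (h (shift d (unitv d i) ω') - h ω'))
        (fun i => hb (bcfShift (unitv d i) h - h) i), ← integral_neg]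
    congr 1
    refine integral_congr_ae (ae_of_all _ fun ω' => ?_)
    simp only
    have h3 := sum_nbrs_cnd_grad ω' 0 fun x => h (shift d x ω')
    simp only [shift_zero] at h3
    rw [h3]
    simp only [shift_shift, shift_apply, zero_sub, zero_add, neg_add_cancel, shift_zero,
      add_neg_cancel]
    field_simp [(piOf_pos hd ω' 0).ne']
  rw [h1, h2, mul_left_comm, ← mul_sub, mul_neg, Finset.mul_sum, ← Finset.sum_neg_distrib,
    ← Finset.sum_sub_distrib]
  congr 1
  refine Finset.sum_congr rfl fun i _ => ?_
  have h4 : Integrable (fun ω' : EnvSp d =>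
      ω'.1 (0, i) * u i ω' * (h (shift d (unitv d i) ω') - h ω')) P :=
    (hb (u i * (bcfShift (unitv d i) h - h)) i).congr (ae_of_all _ fun ω' => by
      simp [mul_assoc])
  have h5 : Integrable (fun ω' : EnvSp d => ω'.1 (0, i) * (h (shift d (unitv d i) ω') - h ω') *
      (h (shift d (unitv d i) ω') - h ω')) P :=
    (hb ((bcfShift (unitv d i) h - h) * (bcfShift (unitv d i) h - h)) i).congr
      (ae_of_all _ fun ω' => by simp [mul_assoc])
  rw [← neg_mul, ← integral_const_mul, ← integral_sub (h4.const_mul _) h5]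
  refine integral_congr_ae (ae_of_all _ fun ω' => ?_)
  simp only [primalDensity]
  ring

/-- The variational set of the environment generator in terms of gradients. -/
lemma mem_invPairSet_iff (hd : 1 ≤ d) {P : Measure (EnvSp d)}
    (hinv : ∀ x, MeasurePreserving (shift d x) P P)
    (hc : ∀ i, Integrable (fun ω' : EnvSp d => ω'.1 (0, i)) P) (u : Fin d → (EnvSp d →ᵇ ℝ))
    {r : ℝ} : r ∈ invPairSet d (Qmeas d P) (fDiv d fun ω i => u i ω) ↔
      ∃ h : EnvSp d →ᵇ ℝ,
        r = (∫ ω', piOf d ω' 0 ∂P)⁻¹ * ∑ i, ∫ ω', primalDensity u h i ω' ∂P := by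
  constructor
  · rintro ⟨h, hh, ⟨M, hM⟩, rfl⟩
    exact ⟨.ofNormedAddCommGroup h hh M hM, two_mul_innerQ_sub_quadQ hd hinv hc u
      (.ofNormedAddCommGroup h hh M hM)⟩
  · rintro ⟨h, rfl⟩
    exact ⟨h, h.continuous, ⟨‖h‖, h.norm_coe_le_norm⟩,
      (two_mul_innerQ_sub_quadQ hd hinv hc u h).symm⟩

end Identities

section Convergence

variable {d : ℕ}

open BoundedContinuousFunction

lemma IsEnvLaw.avgTo_of_edge_le {ω : EnvSp d} {P : Measure (EnvSp d)} (hP : IsEnvLaw d ω P)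
    {F : EnvSp d → ℝ} (hF : Continuous F) {s : ℝ} (hs : 1 < s) {ρ : EdgeIx d → ℝ}
    (hρ : ∀ e, 0 ≤ ρ e)
    (hm : ∃ C : ℝ, ∀ n : ℕ, 1 ≤ n →
      (∑ e ∈ edgesIn d (box d (n : ℝ)), ρ e ^ s) / (n : ℝ) ^ d ≤ C)
    {e : Vert d → EdgeIx d} (he : Function.Injective e)
    (he' : ∀ Λ : Finset (Vert d), ∀ x ∈ Λ, e x ∈ edgesIn d Λ) {K : ℝ}
    (hK : ∀ x, |F (shift d x ω)| ≤ K * ρ (e x)) :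
    Integrable F P ∧ avgTo d ω F (∫ ω', F ω' ∂P) := by
  obtain ⟨C, hC⟩ := hm
  refine hP.avgTo_of_moment hF hs (C := |K| ^ s * C) fun n hn => ?_
  have hn0 : (0 : ℝ) < (n : ℝ) ^ d := by positivity
  have h1 : ∑ x ∈ box d (n : ℝ), ρ (e x) ^ s ≤ ∑ e ∈ edgesIn d (box d (n : ℝ)), ρ e ^ s := by
    rw [← Finset.sum_image (f := fun e => ρ e ^ s) he.injOn]
    refine Finset.sum_le_sum_of_subset_of_nonneg ?_ fun e _ _ => Real.rpow_nonneg (hρ e) s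
    exact Finset.image_subset_iff.2 (he' _)
  have h0 : 0 ≤ C := (div_nonneg (Finset.sum_nonneg fun e _ => Real.rpow_nonneg (hρ e) s)
    hn0.le).trans (hC n hn)
  have h2 := (div_le_iff₀ hn0).1 (hC n hn)
  have h3 : (n : ℝ) ^ d ≤ ((box d (n : ℝ)).card : ℝ) := by
    rw [card_box_natCast]
    push_cast
    gcongr
    linarith [(Nat.cast_nonneg n : (0 : ℝ) ≤ n)]
  calc ∑ x ∈ box d (n : ℝ), |F (shift d x ω)| ^ s
      ≤ ∑ x ∈ box d (n : ℝ), |K| ^ s * ρ (e x) ^ s := by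
        refine Finset.sum_le_sum fun x _ => ?_
        rw [← Real.mul_rpow (abs_nonneg _) (hρ _)]
        refine Real.rpow_le_rpow (abs_nonneg _) ((hK x).trans ?_) (by linarith)
        exact mul_le_mul_of_nonneg_right (le_abs_self K) (hρ _)
    _ = |K| ^ s * ∑ x ∈ box d (n : ℝ), ρ (e x) ^ s := by rw [Finset.mul_sum]
    _ ≤ |K| ^ s * (C * ((box d (n : ℝ)).card : ℝ)) := by
        gcongr
        exact (h1.trans h2).trans (mul_le_mul_of_nonneg_left h3 h0)
    _ = _ := by ring

lemma mem_edgesIn {Λ : Finset (Vert d)} {x : Vert d} (hx : x ∈ Λ) (i : Fin d) :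
    (x, i) ∈ edgesIn d Λ :=
  Finset.mem_biUnion.2 ⟨x, hx, by simp⟩

lemma sub_unitv_mem_edgesIn {Λ : Finset (Vert d)} {x : Vert d} (hx : x ∈ Λ) (i : Fin d) :
    (x - unitv d i, i) ∈ edgesIn d Λ :=
  Finset.mem_biUnion.2 ⟨x, hx, by simp⟩

lemma IsEnvLaw.avgTo_mul_bcf {p q : ℝ} {ω : EnvSp d} {P : Measure (EnvSp d)}
    (hP : IsEnvLaw d ω P) (hp : 1 < p) (hmom : InOmegaPQ d p q ω) (i : Fin d)
    (g : EnvSp d →ᵇ ℝ) : Integrable (fun ω' => ω'.1 (0, i) * g ω') P ∧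
      avgTo d ω (fun ω' => ω'.1 (0, i) * g ω') (∫ ω', ω'.1 (0, i) * g ω' ∂P) := by
  refine hP.avgTo_of_edge_le ((continuous_coord d _).mul g.continuous) hp (fun e => (ω.2 e).le)
    hmom.1 (e := fun x => (x, i)) (fun x y h => (Prod.ext_iff.1 h).1)
    (fun Λ x hx => mem_edgesIn hx i) (K := ‖g‖) fun x => ?_
  rw [abs_mul, abs_of_pos ((shift d x ω).2 _), shift_apply, zero_add, mul_comm]
  exact mul_le_mul_of_nonneg_right (g.norm_coe_le_norm _) (ω.2 _).le

lemma IsEnvLaw.avgTo_div_bcf {p q : ℝ} {ω : EnvSp d} {P : Measure (EnvSp d)}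
    (hP : IsEnvLaw d ω P) (hq : 1 < q) (hmom : InOmegaPQ d p q ω) (i : Fin d)
    (g : EnvSp d →ᵇ ℝ) : Integrable (fun ω' => (ω'.1 (0, i))⁻¹ * g ω') P ∧
      avgTo d ω (fun ω' => (ω'.1 (0, i))⁻¹ * g ω') (∫ ω', (ω'.1 (0, i))⁻¹ * g ω' ∂P) := by
  have h : ∀ e, (ω.1 e)⁻¹ ^ q = ω.1 e ^ (-q) := fun e => by
    rw [Real.inv_rpow (ω.2 e).le, Real.rpow_neg (ω.2 e).le]
  refine hP.avgTo_of_edge_le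
    (((continuous_coord d _).inv₀ fun ω' => (ω'.2 _).ne').mul g.continuous) hq
    (ρ := fun e => (ω.1 e)⁻¹) (fun e => (inv_pos.2 (ω.2 e)).le)
    (by simpa only [h] using hmom.2) (e := fun x => (x, i))
    (fun x y h => (Prod.ext_iff.1 h).1)
    (fun Λ x hx => mem_edgesIn hx i) (K := ‖g‖) fun x => ?_
  rw [abs_mul, abs_of_pos (inv_pos.2 ((shift d x ω).2 _)), shift_apply, zero_add, mul_comm]
  exact mul_le_mul_of_nonneg_right (g.norm_coe_le_norm _) (inv_pos.2 (ω.2 _)).le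

lemma IsEnvLaw.avgTo_piOf {p q : ℝ} {ω : EnvSp d} {P : Measure (EnvSp d)}
    (hP : IsEnvLaw d ω P) (hp : 1 < p) (hmom : InOmegaPQ d p q ω) :
    avgTo d ω (fun ω' => piOf d ω' 0) (∫ ω', piOf d ω' 0 ∂P) := by
  have h1 : ∀ i, Integrable (fun ω' : EnvSp d => ω'.1 (0, i)) P ∧
      avgTo d ω (fun ω' => ω'.1 (0, i)) (∫ ω', ω'.1 (0, i) ∂P) := fun i => by
    simpa using hP.avgTo_mul_bcf hp hmom i 1
  have h2 : ∀ i, Integrable (fun ω' : EnvSp d => ω'.1 (0 - unitv d i, i)) P ∧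
      avgTo d ω (fun ω' => ω'.1 (0 - unitv d i, i)) (∫ ω', ω'.1 (0 - unitv d i, i) ∂P) :=
    fun i => by
      refine hP.avgTo_of_edge_le (continuous_coord d _) hp (fun e => (ω.2 e).le) hmom.1
        (e := fun x => (x - unitv d i, i)) (fun x y h => sub_left_injective (Prod.ext_iff.1 h).1)
        (fun Λ x hx => sub_unitv_mem_edgesIn hx i) (K := 1) fun x => ?_
      rw [abs_of_pos ((shift d x ω).2 _), shift_apply, one_mul, zero_sub, neg_add_eq_sub]
  have h3 : ∀ i, Integrable (fun ω' : EnvSp d => ω'.1 (0, i) + ω'.1 (0 - unitv d i, i)) P :=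
    fun i => (h1 i).1.add (h2 i).1
  simp only [piOf]
  rw [integral_finsetSum _ fun i _ => h3 i]
  refine avgTo.sum _ fun i _ => ?_
  rw [integral_add (h1 i).1 (h2 i).1]
  exact (h1 i).2.add (h2 i).2

lemma IsEnvLaw.avgTo_primalDensity {p q : ℝ} {ω : EnvSp d} {P : Measure (EnvSp d)}
    (hP : IsEnvLaw d ω P) (hp : 1 < p) (hmom : InOmegaPQ d p q ω)
    (u : Fin d → (EnvSp d →ᵇ ℝ)) (h : EnvSp d →ᵇ ℝ) (i : Fin d) :
    avgTo d ω (primalDensity u h i) (∫ ω', primalDensity u h i ω' ∂P) := by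
  have := (hP.avgTo_mul_bcf hp hmom i (-(2 : ℝ) • u i * (bcfShift (unitv d i) h - h) -
    (bcfShift (unitv d i) h - h) ^ 2)).2
  unfold primalDensity
  simpa using this

lemma dualDensity_eq (u j : Fin d → (EnvSp d →ᵇ ℝ)) (i : Fin d) (ω : EnvSp d) :
    dualDensity u j i ω = ω.1 (0, i) * (u i * u i) ω + ((-(2 : ℝ) • (u i * j i)) ω +
      (ω.1 (0, i))⁻¹ * (j i * j i) ω) := by
  have := (ω.2 (0, i)).ne'
  simp only [dualDensity, BoundedContinuousFunction.mul_apply,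
    BoundedContinuousFunction.coe_smul, smul_eq_mul]
  field_simp
  ring

lemma IsEnvLaw.avgTo_dualDensity {p q : ℝ} {ω : EnvSp d} {P : Measure (EnvSp d)}
    (hP : IsEnvLaw d ω P) (hp : 1 < p) (hq : 1 < q) (hmom : InOmegaPQ d p q ω)
    (u j : Fin d → (EnvSp d →ᵇ ℝ)) (i : Fin d) :
    avgTo d ω (dualDensity u j i) (∫ ω', dualDensity u j i ω' ∂P) := by
  have := hP.1
  have h1 := hP.avgTo_mul_bcf hp hmom i (u i * u i)
  have h3 := hP.avgTo_div_bcf hq hmom i (j i * j i)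
  set g : EnvSp d →ᵇ ℝ := -(2 : ℝ) • (u i * j i)
  have h2 := hP.2 g g.continuous ⟨‖g‖, g.norm_coe_le_norm⟩
  have h2' : Integrable g P := g.integrable P
  have h4 : Integrable (fun ω' => g ω' + (ω'.1 (0, i))⁻¹ * (j i * j i) ω') P := h2'.add h3.1
  rw [show dualDensity u j i = _ from funext (dualDensity_eq u j i)]
  beta_reduce
  rw [integral_add h1.1 h4, integral_add h2' h3.1]
  exact h1.2.add (h2.add h3.2)

lemma primal_le_dual {c : ℝ} (hc : 0 < c) (u j g : ℝ) :
    c * (-2 * u * g - g ^ 2) ≤ (c * u - j) ^ 2 / c - 2 * (j * g) := by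
  rw [← sub_nonneg]
  have : (c * u - j) ^ 2 / c - 2 * (j * g) - c * (-2 * u * g - g ^ 2) =
      (c * u - j + c * g) ^ 2 / c := by
    field_simp
    ring
  rw [this]
  positivity

/-- Every divergence-free field bounds the finite-volume variational functional. -/
lemma two_mul_innerF_sub_quadF_le (hd : 1 ≤ d) (u : Fin d → (EnvSp d →ᵇ ℝ))
    {j : Fin d → (EnvSp d →ᵇ ℝ)} (hj : j ∈ divFree d) (ω : EnvSp d) {n : ℕ} {h : Vert d → ℝ}
    (hh : ∀ x ∉ box d (n : ℝ), h x = 0) :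
    2 * innerF d ω (box d (n : ℝ)) h (fun x => fDiv d (fun ω i => u i ω) (shift d x ω)) -
        quadF d ω (box d (n : ℝ)) h ≤
      ∑ y ∈ box d ((n + 1 : ℕ) : ℝ), ∑ i, dualDensity u j i (shift d y ω) := by
  have h1 : ∑ y ∈ box d ((n + 1 : ℕ) : ℝ), ∑ i,
      j i (shift d y ω) * (h (y + unitv d i) - h y) = 0 := by
    rw [← neg_eq_zero, ← sum_box_mul_div hh fun y i => j i (shift d y ω)]
    refine Finset.sum_eq_zero fun x _ => ?_
    have := mem_divFree.1 hj (shift d x ω)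
    simp only [shift_shift, neg_add_eq_sub] at this
    rw [this, mul_zero]
  have h2 : ∑ y ∈ box d ((n + 1 : ℕ) : ℝ), ∑ i, (dualDensity u j i (shift d y ω) -
      2 * (j i (shift d y ω) * (h (y + unitv d i) - h y))) =
      ∑ y ∈ box d ((n + 1 : ℕ) : ℝ), ∑ i, dualDensity u j i (shift d y ω) := by
    simp only [Finset.sum_sub_distrib, ← Finset.mul_sum]
    rw [h1, mul_zero, sub_zero]
  rw [two_mul_innerF_sub_quadF hd _ ω hh, ← h2]
  refine Finset.sum_le_sum fun y _ => Finset.sum_le_sum fun i _ => ?_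
  rw [dualDensity, shift_apply, zero_add]
  exact primal_le_dual (ω.2 _) _ _ _

lemma invPairF_le (hd : 1 ≤ d) (u : Fin d → (EnvSp d →ᵇ ℝ))
    {j : Fin d → (EnvSp d →ᵇ ℝ)} (hj : j ∈ divFree d) (ω : EnvSp d) (n : ℕ) :
    invPairF d ω (box d (n : ℝ)) (fun x => fDiv d (fun ω i => u i ω) (shift d x ω)) ≤
      ∑ y ∈ box d ((n + 1 : ℕ) : ℝ), ∑ i, dualDensity u j i (shift d y ω) := by
  refine csSup_le ⟨_, 0, fun _ _ => rfl, rfl⟩ ?_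
  rintro _ ⟨h, hh, rfl⟩
  exact two_mul_innerF_sub_quadF_le hd u hj ω hh

lemma le_invPairF (hd : 1 ≤ d) (u : Fin d → (EnvSp d →ᵇ ℝ)) (ω : EnvSp d) {n : ℕ}
    {h : Vert d → ℝ} (hh : ∀ x ∉ box d (n : ℝ), h x = 0) :
    2 * innerF d ω (box d (n : ℝ)) h (fun x => fDiv d (fun ω i => u i ω) (shift d x ω)) -
        quadF d ω (box d (n : ℝ)) h ≤
      invPairF d ω (box d (n : ℝ)) (fun x => fDiv d (fun ω i => u i ω) (shift d x ω)) := by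
  refine le_csSup ⟨∑ y ∈ box d ((n + 1 : ℕ) : ℝ), ∑ i, dualDensity u 0 i (shift d y ω), ?_⟩
    ⟨h, hh, rfl⟩
  rintro _ ⟨k, hk, rfl⟩
  exact two_mul_innerF_sub_quadF_le hd u (zero_mem _) ω hk

/-- Truncating a stationary test function to a box costs only a boundary term. -/
lemma sum_primalDensity_le_invPairF (hd : 1 ≤ d) (u : Fin d → (EnvSp d →ᵇ ℝ))
    (H : EnvSp d →ᵇ ℝ) (ω : EnvSp d) (n : ℕ) :
    ∑ y ∈ box d (n : ℝ), ∑ i, (primalDensity u H i (shift d y ω) +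
        (4 * ‖u i‖ * ‖H‖ + 4 * ‖H‖ ^ 2) * (shift d y ω).1 (0, i)) -
      ∑ y ∈ box d ((n + 2 : ℕ) : ℝ), ∑ i,
        (4 * ‖u i‖ * ‖H‖ + 4 * ‖H‖ ^ 2) * (shift d y ω).1 (0, i) ≤
      invPairF d ω (box d ((n + 1 : ℕ) : ℝ))
        (fun x => fDiv d (fun ω i => u i ω) (shift d x ω)) := by
  classical
  set h : Vert d → ℝ := fun x => if x ∈ box d ((n + 1 : ℕ) : ℝ) then H (shift d x ω) else 0
  have hh : ∀ x ∉ box d ((n + 1 : ℕ) : ℝ), h x = 0 := fun x hx => if_neg hx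
  refine le_trans ?_ (le_invPairF hd u ω hh)
  rw [two_mul_innerF_sub_quadF hd _ ω hh, sub_le_iff_le_add, ← Finset.sum_add_distrib]
  simp only [← Finset.sum_add_distrib]
  have hH : ∀ x, |h x| ≤ ‖H‖ := fun x => by
    by_cases hx : x ∈ box d ((n + 1 : ℕ) : ℝ)
    · simpa only [h, if_pos hx, Real.norm_eq_abs] using H.norm_coe_le_norm _
    · simpa only [h, if_neg hx, abs_zero] using norm_nonneg H
  have hnn : ∀ y i, 0 ≤ ω.1 (y, i) * (-2 * u i (shift d y ω) * (h (y + unitv d i) - h y) -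
      (h (y + unitv d i) - h y) ^ 2) +
        (4 * ‖u i‖ * ‖H‖ + 4 * ‖H‖ ^ 2) * (shift d y ω).1 (0, i) := fun y i => by
    rw [shift_apply, zero_add, mul_comm _ (ω.1 (y, i)), ← mul_add]
    refine mul_nonneg (ω.2 _).le ?_
    have h1 : |h (y + unitv d i) - h y| ≤ 2 * ‖H‖ :=
      (abs_sub _ _).trans (by linarith [hH (y + unitv d i), hH y])
    have h2 : |u i (shift d y ω)| ≤ ‖u i‖ := (u i).norm_coe_le_norm _
    have h3 : |u i (shift d y ω) * (h (y + unitv d i) - h y)| ≤ ‖u i‖ * (2 * ‖H‖) := by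
      rw [abs_mul]
      exact mul_le_mul h2 h1 (abs_nonneg _) (norm_nonneg _)
    have h4 : (h (y + unitv d i) - h y) ^ 2 ≤ (2 * ‖H‖) ^ 2 := sq_le_sq' (abs_le.1 h1).1
      (abs_le.1 h1).2
    nlinarith [(abs_le.1 h3).2]
  refine le_trans (Finset.sum_le_sum fun y hy => Finset.sum_le_sum fun i _ => ?_)
    (Finset.sum_le_sum_of_subset_of_nonneg (box_subset_box (show n ≤ n + 2 by omega))
      fun y _ _ => Finset.sum_nonneg fun i _ => hnn y i)
  rw [primalDensity, shift_shift, shift_apply, zero_add]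
  simp only [h, if_pos (add_unitv_mem_box hy i), if_pos (box_subset_box n.le_succ hy)]
  rw [add_comm y]

end Convergence

section Homogenization

variable {d : ℕ}

open BoundedContinuousFunction

lemma sum_integral_primalDensity_le {p q : ℝ} {ω : EnvSp d} {P : Measure (EnvSp d)}
    (hP : IsEnvLaw d ω P) (hp : 1 < p) (hq : 1 < q) (hmom : InOmegaPQ d p q ω)
    (u : Fin d → (EnvSp d →ᵇ ℝ)) (h : EnvSp d →ᵇ ℝ) :
    ∑ i, ∫ ω', primalDensity u h i ω' ∂P ≤ ∑ i, ∫ ω', dualDensity u 0 i ω' ∂P := by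
  refine Finset.sum_le_sum fun i _ => ?_
  refine le_of_tendsto_of_tendsto' (hP.avgTo_primalDensity hp hmom u h i)
    (hP.avgTo_dualDensity hp hq hmom u 0 i) fun n => ?_
  refine div_le_div_of_nonneg_right (Finset.sum_le_sum fun x _ => ?_) (card_box_pos d n).le
  refine (primal_le_dual ((shift d x ω).2 _) _ 0 _).trans_eq ?_
  simp [dualDensity]

variable {p q : ℝ} {ω : EnvSp d} {P : Measure (EnvSp d)}

lemma eventually_lt_invPairF (hd : 1 ≤ d) (hP : IsEnvLaw d ω P) (hp : 1 < p)
    (hmom : InOmegaPQ d p q ω) (hZ : 0 < ∫ ω', piOf d ω' 0 ∂P)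
    (u : Fin d → (EnvSp d →ᵇ ℝ)) (h : EnvSp d →ᵇ ℝ) {a : ℝ}
    (ha : a < (∫ ω', piOf d ω' 0 ∂P)⁻¹ * ∑ i, ∫ ω', primalDensity u h i ω' ∂P) :
    ∀ᶠ r : ℕ in atTop, a < (∑ x ∈ box d (r : ℝ), piOf d ω x)⁻¹ *
      invPairF d ω (box d (r : ℝ)) (fun x => fDiv d (fun ω i => u i ω) (shift d x ω)) := by
  rw [← map_add_atTop_eq_nat 1, eventually_map]
  have h1 : ∀ i, avgTo d ω (fun ω' => (4 * ‖u i‖ * ‖h‖ + 4 * ‖h‖ ^ 2) * ω'.1 (0, i))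
      ((4 * ‖u i‖ * ‖h‖ + 4 * ‖h‖ ^ 2) * ∫ ω', ω'.1 (0, i) ∂P) := fun i => by
    refine avgTo.const_mul ?_ _
    simpa using (hP.avgTo_mul_bcf hp hmom i 1).2
  have h2 := avgTo.sum Finset.univ fun i _ =>
    (hP.avgTo_primalDensity hp hmom u h i).add (h1 i)
  have h3 := (avgTo.sum Finset.univ fun i _ => h1 i).tendsto_add 2
  have h4 := (((hP.avgTo_piOf hp hmom).tendsto_add 1).inv₀ hZ.ne').mul (Tendsto.sub h2 h3)
  rw [Finset.sum_add_distrib, add_sub_cancel_right] at h4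
  filter_upwards [h4.eventually (lt_mem_nhds ha)] with n hn
  refine hn.trans_le ?_
  have hX : 0 ≤ ∑ x ∈ box d ((n + 1 : ℕ) : ℝ), piOf d ω x :=
    Finset.sum_nonneg fun x _ => (piOf_pos hd ω x).le
  simp only [piOf_shift]
  rw [← sub_div, inv_div, div_mul_div_comm, mul_comm, mul_div_mul_right _ _ (card_box_pos d n).ne',
    div_eq_inv_mul]
  exact mul_le_mul_of_nonneg_left (sum_primalDensity_le_invPairF hd u h ω n) (inv_nonneg.2 hX)

lemma eventually_invPairF_lt (hd : 1 ≤ d) (hP : IsEnvLaw d ω P) (hp : 1 < p) (hq : 1 < q)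
    (hmom : InOmegaPQ d p q ω) (hZ : 0 < ∫ ω', piOf d ω' 0 ∂P)
    (u : Fin d → (EnvSp d →ᵇ ℝ)) {j : Fin d → (EnvSp d →ᵇ ℝ)} (hj : j ∈ divFree d) {a : ℝ}
    (ha : (∫ ω', piOf d ω' 0 ∂P)⁻¹ * ∑ i, ∫ ω', dualDensity u j i ω' ∂P < a) :
    ∀ᶠ r : ℕ in atTop, (∑ x ∈ box d (r : ℝ), piOf d ω x)⁻¹ *
      invPairF d ω (box d (r : ℝ)) (fun x => fDiv d (fun ω i => u i ω) (shift d x ω)) < a := by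
  have h1 := (avgTo.sum Finset.univ fun i _ =>
    hP.avgTo_dualDensity hp hq hmom u j i).tendsto_add 1
  have h2 := (Tendsto.inv₀ (hP.avgTo_piOf hp hmom) hZ.ne').mul h1
  filter_upwards [h2.eventually (gt_mem_nhds ha)] with n hn
  refine lt_of_le_of_lt ?_ hn
  have hX : 0 ≤ ∑ x ∈ box d (n : ℝ), piOf d ω x :=
    Finset.sum_nonneg fun x _ => (piOf_pos hd ω x).le
  simp only [piOf_shift]
  rw [inv_div, div_mul_div_comm, mul_comm (_ : ℝ) (∑ x ∈ _, ∑ i, _),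
    mul_div_mul_right _ _ (card_box_pos d n).ne', div_eq_inv_mul]
  exact mul_le_mul_of_nonneg_left (invPairF_le hd u hj ω n) (inv_nonneg.2 hX)

lemma tendsto_invPairF (hd : 1 ≤ d) (hp : 1 < p) (hq : 1 < q) (hstar : InOmegaStar d ω)
    (hmom : InOmegaPQ d p q ω) (hP : IsEnvLaw d ω P) (u : Fin d → (EnvSp d →ᵇ ℝ)) :
    BddAbove (invPairSet d (Qmeas d P) (fDiv d fun ω i => u i ω)) ∧
    Tendsto (fun r : ℕ => (∑ x ∈ box d (r : ℝ), piOf d ω x)⁻¹ *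
        invPairF d ω (box d (r : ℝ)) (fun x => fDiv d (fun ω i => u i ω) (shift d x ω))) atTop
      (𝓝 (sSup (invPairSet d (Qmeas d P) (fDiv d fun ω i => u i ω)))) := by
  have := hP.1
  have hinv := hP.measurePreserving
  have hc : ∀ i, Integrable (fun ω' : EnvSp d => ω'.1 (0, i)) P := fun i => by
    simpa using (hP.avgTo_mul_bcf hp hmom i 1).1
  have hc' : ∀ i, Integrable (fun ω' : EnvSp d => (ω'.1 (0, i))⁻¹) P := fun i => by
    simpa using (hP.avgTo_div_bcf hq hmom i 1).1
  have hZ := integral_piOf_pos hd (integrable_piOf hinv hc)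
  have hmem := fun r => mem_invPairSet_iff hd hinv hc u (r := r)
  have hbdd : BddAbove (invPairSet d (Qmeas d P) (fDiv d fun ω i => u i ω)) := by
    refine ⟨(∫ ω', piOf d ω' 0 ∂P)⁻¹ * ∑ i, ∫ ω', dualDensity u 0 i ω' ∂P, fun r hr => ?_⟩
    obtain ⟨h, rfl⟩ := (hmem r).1 hr
    exact mul_le_mul_of_nonneg_left (sum_integral_primalDensity_le hP hp hq hmom u h)
      (inv_nonneg.2 hZ.le)
  refine ⟨hbdd, tendsto_order.2 ⟨fun a ha => ?_, fun a ha => ?_⟩⟩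
  · obtain ⟨r, hr, har⟩ := exists_lt_of_lt_csSup ⟨_, (hmem _).2 ⟨0, rfl⟩⟩ ha
    obtain ⟨h, rfl⟩ := (hmem r).1 hr
    exact eventually_lt_invPairF hd hP hp hmom hZ u h har
  · set S := sSup (invPairSet d (Qmeas d P) (fDiv d fun ω i => u i ω))
    set Z := ∫ ω', piOf d ω' 0 ∂P
    obtain ⟨h, j, hj, hgap⟩ := exists_duality_gap_le (hstar.2.2 P hP) hinv hc hc' u
      (mul_pos hZ (half_pos (sub_pos.2 ha)))
    have h1 : Z⁻¹ * ∑ i, ∫ ω', primalDensity u h i ω' ∂P ≤ S :=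
      le_csSup hbdd ((hmem _).2 ⟨h, rfl⟩)
    refine eventually_invPairF_lt hd hP hp hq hmom hZ u hj ?_
    calc Z⁻¹ * ∑ i, ∫ ω', dualDensity u j i ω' ∂P
        ≤ Z⁻¹ * (∑ i, ∫ ω', primalDensity u h i ω' ∂P + Z * ((a - S) / 2)) :=
          mul_le_mul_of_nonneg_left hgap (inv_nonneg.2 hZ.le)
      _ = Z⁻¹ * ∑ i, ∫ ω', primalDensity u h i ω' ∂P + (a - S) / 2 := by
          rw [mul_add, inv_mul_cancel_left₀ hZ.ne']
      _ < a := by linarith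

end Homogenization

/-- STATEMENT 12 (Theorem 5.1): homogenization of the inverse generator. -/
theorem statement12 (d : ℕ) (hd : 1 ≤ d) (v : EnvSp d → Fin d → ℝ)
    (hv : Continuous v) (hvb : IsBddV d v)
    (p q : ℝ) (hp : 1 < p) (hq : 1 < q)
    (ω : EnvSp d) (hstar : InOmegaStar d ω) (hmom : InOmegaPQ d p q ω)
    (P : Measure (EnvSp d)) (hP : IsEnvLaw d ω P) :
    BddAbove (invPairSet d (Qmeas d P) (fDiv d v)) ∧
    Tendsto (fun r : ℕ =>
        (∑ x ∈ box d (r : ℝ), piOf d ω x)⁻¹ *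
          invPairF d ω (box d (r : ℝ)) (fun x => fDiv d v (shift d x ω))) atTop
      (𝓝 (sSup (invPairSet d (Qmeas d P) (fDiv d v)))) := by
  obtain ⟨M, hM⟩ := hvb
  exact tendsto_invPairF hd hp hq hstar hmom hP fun i =>
    .ofNormedAddCommGroup (fun ω => v ω i) ((continuous_apply i).comp hv) M fun ω => hM ω i


end DetCond
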